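/- arXiv:1306.1810 — 2 statements merged into one kernel-verified Lean document; each statement's English description precedes it below -/
import Mathlib

section
/- Let v, w ∈ k^{r×n} and suppose there is a bijection σ of {1,…,n} such that for every S ⊆ {1,…,n}, the columns {v_j : j ∈ S} are linearly independent if and only if the columns {w_{σ(j)} : j ∈ S} are linearly independent. Then there is a k-linear isomorphism Ψ : 𝔖(v) → 𝔖(w) satisfying Ψ(π·x) = π·Ψ(x) for all π ∈ S_n and x ∈ 𝔖(v); that is, the isomorphism type of the S_n-module 𝔖(v) is a function of the unlabeled matroid of v. -/
noncomputable section

/-- The action of a permutation `σ ∈ S_n` on `(k^r)^{⊗n}` by permuting tensor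
factors. -/
def permAct (k : Type*) [Field k] {r n : ℕ} (σ : Equiv.Perm (Fin n)) :
    (PiTensorProduct k fun _ : Fin n => Fin r → k) →ₗ[k]
      (PiTensorProduct k fun _ : Fin n => Fin r → k) :=
  (PiTensorProduct.reindex k (fun _ : Fin n => Fin r → k) σ).toLinearMap

/-- The decomposable tensor `v₁ ⊗ ⋯ ⊗ v_n` of the columns of `v`. -/
def vtens (k : Type*) [Field k] {r n : ℕ} (v : Matrix (Fin r) (Fin n) k) :
    PiTensorProduct k fun _ : Fin n => Fin r → k :=
  PiTensorProduct.tprod k fun j => fun i => v i j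

/-- The module `𝔖(v)`: the cyclic `S_n`-module generated by `v₁ ⊗ ⋯ ⊗ v_n`. -/
def symMod (k : Type*) [Field k] {r n : ℕ} (v : Matrix (Fin r) (Fin n) k) :
    Submodule k (PiTensorProduct k fun _ : Fin n => Fin r → k) :=
  Submodule.span k {x | ∃ σ : Equiv.Perm (Fin n), x = permAct k σ (vtens k v)}

section Characters

open Representation

variable {k G M N : Type*} [Field k] [Group G]
  [AddCommGroup M] [Module k M] [Module (MonoidAlgebra k G) M] [IsScalarTower k (MonoidAlgebra k G) M]
  [AddCommGroup N] [Module k N] [Module (MonoidAlgebra k G) N] [IsScalarTower k (MonoidAlgebra k G) N]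

theorem ofModule'_apply_eq_smul (g : G) (x : M) :
    ofModule' (k := k) (G := G) M g x = MonoidAlgebra.of k G g • x := by
  simp [ofModule']

theorem character_ofModule'_congr (e : M ≃ₗ[MonoidAlgebra k G] N) (g : G) :
    character (ofModule' (k := k) M) g = character (ofModule' (k := k) N) g := by
  rw [character, character, ← LinearMap.trace_conj' _ (e.restrictScalars k)]
  congr 1
  ext x
  rw [LinearEquiv.conj_apply_apply, ofModule'_apply_eq_smul, ofModule'_apply_eq_smul,
    LinearEquiv.restrictScalars_apply, map_smul]
  congr 1
  exact e.apply_symm_apply x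

theorem character_ofModule'_prod [FiniteDimensional k M] [FiniteDimensional k N] (g : G) :
    character (ofModule' (k := k) (M × N)) g =
      character (ofModule' (k := k) M) g + character (ofModule' (k := k) N) g := by
  rw [character, character, character, ← LinearMap.trace_prodMap']
  congr 1

theorem character_ofModule'_of_isCompl [FiniteDimensional k M]
    {p q : Submodule (MonoidAlgebra k G) M} (h : IsCompl p q) (g : G) :
    character (ofModule' (k := k) M) g =
      character (ofModule' (k := k) p) g + character (ofModule' (k := k) q) g := by
  have : FiniteDimensional k p :=
    inferInstanceAs (FiniteDimensional k (p.restrictScalars k))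
  have : FiniteDimensional k q :=
    inferInstanceAs (FiniteDimensional k (q.restrictScalars k))
  rw [← character_ofModule'_prod, character_ofModule'_congr (p.prodEquivOfIsCompl q h)]

theorem finrank_intertwiningMap_eq_of_character_eq [CharZero k] [Fintype G] {U V W : Type*}
    [AddCommGroup U] [Module k U] [FiniteDimensional k U]
    [AddCommGroup V] [Module k V] [FiniteDimensional k V]
    [AddCommGroup W] [Module k W] [FiniteDimensional k W] (ρ : Representation k G U)
    {σ : Representation k G V} {τ : Representation k G W}
    (h : ∀ g, σ.character g = τ.character g) :
    Module.finrank k (IntertwiningMap ρ σ) = Module.finrank k (IntertwiningMap ρ τ) := by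
  have : Invertible (Nat.card G : k) :=
    invertibleOfNonzero (Nat.cast_ne_zero.2 Nat.card_pos.ne')
  have h1 := card_inv_mul_sum_char_mul_char_eq_finrank ρ σ
  have h2 := card_inv_mul_sum_char_mul_char_eq_finrank ρ τ
  simp_rw [h] at h1
  exact_mod_cast h1.symm.trans h2

def intertwiningMapToLinearMap (f : IntertwiningMap (ofModule' (k := k) (G := G) M)
    (ofModule' (k := k) (G := G) N)) : M →ₗ[MonoidAlgebra k G] N where
  toFun := f.toLinearMap
  map_add' := map_add _
  map_smul' a x := by
    induction a using MonoidAlgebra.induction_on with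
    | of g =>
      have := LinearMap.congr_fun (f.isIntertwining' g) x
      rwa [LinearMap.comp_apply, LinearMap.comp_apply, ofModule'_apply_eq_smul,
        ofModule'_apply_eq_smul] at this
    | add a b ha hb => simp only [add_smul, map_add, ha, hb, RingHom.id_apply]
    | smul c a ha =>
      rw [RingHom.id_apply] at ha ⊢
      rw [smul_assoc, map_smul, ha, smul_assoc]

/-- Over a field of characteristic zero, finite-dimensional modules over the group algebra of a
finite group are determined by their characters. -/
theorem nonempty_linearEquiv_of_character_eq [CharZero k] [Fintype G] (d : ℕ) :
    ∀ {M N : Type*} [AddCommGroup M] [Module k M] [Module (MonoidAlgebra k G) M]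
      [IsScalarTower k (MonoidAlgebra k G) M] [FiniteDimensional k M]
      [AddCommGroup N] [Module k N] [Module (MonoidAlgebra k G) N]
      [IsScalarTower k (MonoidAlgebra k G) N] [FiniteDimensional k N],
      Module.finrank k M = d →
      (∀ g : G, character (ofModule' (k := k) M) g = character (ofModule' (k := k) N) g) →
      Nonempty (M ≃ₗ[MonoidAlgebra k G] N) := by
  have : NeZero (Nat.card G : k) := ⟨Nat.cast_ne_zero.2 Nat.card_pos.ne'⟩
  induction d using Nat.strong_induction_on with
  | _ d ih =>
  intro M N _ _ _ _ _ _ _ _ _ _ hd h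
  have hdim : Module.finrank k M = Module.finrank k N := by
    have := h 1
    rw [char_one, char_one] at this
    exact_mod_cast this
  rcases subsingleton_or_nontrivial M with hM | hM
  · have : Subsingleton N := by
      rw [← Module.finrank_zero_iff (R := k), ← hdim, Module.finrank_zero_iff]
      exact hM
    exact ⟨0, 0, fun _ => Subsingleton.elim _ _, fun _ => Subsingleton.elim _ _⟩
  obtain ⟨S, hS⟩ := IsSemisimpleModule.exists_simple_submodule (MonoidAlgebra k G) M
  have : FiniteDimensional k S := inferInstanceAs (FiniteDimensional k (S.restrictScalars k))
  have hpos : 0 < Module.finrank k S := by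
    have := IsSimpleModule.nontrivial (MonoidAlgebra k G) S
    exact Module.finrank_pos
  obtain ⟨f, hf⟩ : ∃ f : S →ₗ[MonoidAlgebra k G] N, f ≠ 0 := by
    have hrank := finrank_intertwiningMap_eq_of_character_eq (ofModule' (k := k) (G := G) S) h
    let f₀ : IntertwiningMap (ofModule' (k := k) (G := G) S) (ofModule' (k := k) (G := G) M) :=
      ⟨S.subtype.restrictScalars k, fun g => by ext x; simp [ofModule'_apply_eq_smul]⟩
    have hne : Nontrivial (IntertwiningMap (ofModule' (k := k) (G := G) S)
        (ofModule' (k := k) (G := G) M)) := by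
      have := IsSimpleModule.nontrivial (MonoidAlgebra k G) S
      obtain ⟨x, hx⟩ := exists_ne (0 : S)
      refine ⟨f₀, 0, fun h => hx (Subtype.ext ?_)⟩
      exact congrArg (fun f => f.toLinearMap x) h
    have : FiniteDimensional k (IntertwiningMap (ofModule' (k := k) (G := G) S)
      (ofModule' (k := k) (G := G) M)) := inferInstance
    have := Module.finrank_pos (R := k) (M := IntertwiningMap (ofModule' (k := k) (G := G) S)
        (ofModule' (k := k) (G := G) M))
    rw [hrank] at this
    have := Module.nontrivial_of_finrank_pos this
    obtain ⟨F, hF⟩ := exists_ne (0 : IntertwiningMap (ofModule' (k := k) (G := G) S)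
        (ofModule' (k := k) (G := G) N))
    refine ⟨intertwiningMapToLinearMap F, fun h => hF ?_⟩
    ext x
    exact LinearMap.congr_fun h x
  have hinj := LinearMap.injective_of_ne_zero hf
  let e : S ≃ₗ[MonoidAlgebra k G] LinearMap.range f := LinearEquiv.ofInjective f hinj
  obtain ⟨C, hC⟩ := exists_isCompl S
  obtain ⟨C', hC'⟩ := exists_isCompl (LinearMap.range f)
  have : FiniteDimensional k C := inferInstanceAs (FiniteDimensional k (C.restrictScalars k))
  have : FiniteDimensional k C' := inferInstanceAs (FiniteDimensional k (C'.restrictScalars k))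
  have hlt : Module.finrank k C < d := by
    have := ((S.prodEquivOfIsCompl C hC).restrictScalars k).finrank_eq
    rw [Module.finrank_prod] at this
    omega
  obtain ⟨e'⟩ := ih _ hlt (M := C) (N := C') rfl fun g => by
    have := h g
    rw [character_ofModule'_of_isCompl hC, character_ofModule'_of_isCompl hC',
      character_ofModule'_congr e] at this
    exact add_left_cancel this
  exact ⟨(S.prodEquivOfIsCompl C hC).symm ≪≫ₗ (e.prodCongr e') ≪≫ₗ
    (Submodule.prodEquivOfIsCompl _ C' hC')⟩

theorem character_ofModule'_asModule {V : Type*} [AddCommGroup V] [Module k V]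
    (σ : Representation k G V) (g : G) :
    character (ofModule' (k := k) σ.asModule) g = σ.character g := by
  rw [character, character, ← LinearMap.trace_conj' _ σ.asModuleEquiv]
  congr 1
  ext x
  rw [LinearEquiv.conj_apply_apply, ofModule'_apply_eq_smul, asModuleEquiv_map_smul,
    asAlgebraHom_of, LinearEquiv.apply_symm_apply]

/-- Over a field of characteristic zero, finite-dimensional representations of a finite group are
determined by their characters. -/
theorem exists_linearEquiv_of_character_eq [CharZero k] [Fintype G] {V W : Type*}
    [AddCommGroup V] [Module k V] [FiniteDimensional k V]
    [AddCommGroup W] [Module k W] [FiniteDimensional k W]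
    {σ : Representation k G V} {τ : Representation k G W}
    (h : ∀ g, σ.character g = τ.character g) :
    ∃ Ψ : V ≃ₗ[k] W, ∀ g x, Ψ (σ g x) = τ g (Ψ x) := by
  obtain ⟨e⟩ := nonempty_linearEquiv_of_character_eq _ (M := σ.asModule) (N := τ.asModule) rfl
    (fun g => by rw [character_ofModule'_asModule, h, character_ofModule'_asModule])
  refine ⟨σ.asModuleEquiv.symm ≪≫ₗ e.restrictScalars k ≪≫ₗ τ.asModuleEquiv, fun g x => ?_⟩
  have he := congrArg τ.asModuleEquiv (e.map_smul (MonoidAlgebra.of k G g) (σ.asModuleEquiv.symm x))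
  rwa [← asModuleEquiv_symm_map_rho, asModuleEquiv_map_smul, asAlgebraHom_of] at he

end Characters

section ClassFunctions

open Equiv

variable {α : Type*} [Fintype α] [DecidableEq α]

theorem Equiv.Perm.image_support_cycleFactorsFinset (g : Perm α) :
    g.cycleFactorsFinset.image Perm.support =
      g.support.image fun i => Finset.univ.filter (g.SameCycle i) := by
  have hsupp : ∀ i ∈ g.support,
      (g.cycleOf i).support = Finset.univ.filter (g.SameCycle i) := by
    intro i hi
    ext j
    rw [Perm.mem_support_cycleOf_iff, Finset.mem_filter, and_iff_left hi,
      and_iff_right (Finset.mem_univ _)]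
  ext s
  rw [Finset.mem_image, Finset.mem_image]
  constructor
  · rintro ⟨p, hp, rfl⟩
    obtain ⟨i, hi⟩ := (Perm.mem_cycleFactorsFinset_iff.1 hp).1.nonempty_support
    refine ⟨i, Perm.mem_cycleFactorsFinset_support_le hp hi, ?_⟩
    rw [Perm.cycle_is_cycleOf hi hp, hsupp i (Perm.mem_cycleFactorsFinset_support_le hp hi)]
  · rintro ⟨i, hi, rfl⟩
    exact ⟨g.cycleOf i, Perm.cycleOf_mem_cycleFactorsFinset_iff.2 hi, hsupp i hi⟩

theorem Equiv.Perm.injOn_support_cycleFactorsFinset (g : Perm α) :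
    Set.InjOn Perm.support (g.cycleFactorsFinset : Set (Perm α)) := by
  intro p hp q hq h
  obtain ⟨i, hi⟩ := (Perm.mem_cycleFactorsFinset_iff.1 hp).1.nonempty_support
  rw [Perm.cycle_is_cycleOf hi hp, Perm.cycle_is_cycleOf (h ▸ hi) hq]

theorem Equiv.Perm.cycleType_eq_of_sameCycle {g h : Perm α}
    (hgh : ∀ i j, g.SameCycle i j ↔ h.SameCycle i j) : g.cycleType = h.cycleType := by
  have hfix : ∀ g : Perm α, ∀ i, g i = i ↔ ∀ j, g.SameCycle i j → i = j := fun g i =>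
    ⟨fun hi j hij => hij.eq_of_left hi, fun hi =>
      (hi _ (Perm.sameCycle_apply_right.2 (Perm.SameCycle.refl g i))).symm⟩
  have hs : g.support = h.support := by
    ext i
    rw [Perm.mem_support, Perm.mem_support, Ne, Ne, hfix, hfix]
    simp_rw [hgh]
  have key : ∀ g : Perm α, g.cycleType =
      (g.support.image fun i => Finset.univ.filter (g.SameCycle i)).val.map Finset.card := by
    intro g
    rw [← Perm.image_support_cycleFactorsFinset,
      Finset.image_val_of_injOn (Perm.injOn_support_cycleFactorsFinset g), Multiset.map_map,
      Perm.cycleType_def]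
  rw [key, key, hs]
  simp_rw [hgh]

/-- A class function whose sums over all Young subgroups vanish is zero. -/
theorem classFunction_eq_zero {k : Type*} [Field k] [CharZero k] (d : Perm α → k)
    (hd : ∀ g h, IsConj g h → d g = d h)
    (hsum : ∀ c : α → α, ∑ g ∈ Finset.univ.filter fun g : Perm α => c ∘ g = c, d g = 0) (g : Perm α) :
    d g = 0 := by
  classical
  let P : Perm α → Finset (α × α) := fun g => Finset.univ.filter fun p => g.SameCycle p.1 p.2
  induction hN : (P g).card using Nat.strong_induction_on generalizing g with
  | _ N ih =>
  subst hN
  let c : α → α := fun i => (Quotient.mk (Perm.SameCycle.setoid g) i).out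
  have hc : ∀ i j, c i = c j ↔ g.SameCycle i j := fun i j => by
    rw [Quotient.out_inj, Quotient.eq]
    rfl
  have hcg : ∀ h : Perm α, c ∘ h = c → P h ⊆ P g := by
    intro h hh p hp
    rw [Finset.mem_filter] at hp ⊢
    refine ⟨Finset.mem_univ _, (hc _ _).1 ?_⟩
    have hc' : ∀ (m : ℤ) (i : α), c ((h ^ m) i) = c i := by
      intro m
      induction m using Int.induction_on with
      | zero => exact fun i => rfl
      | succ m ih =>
        intro i
        rw [zpow_add_one, Perm.mul_apply, ih]
        exact congrFun hh i
      | pred m ih =>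
        intro i
        rw [zpow_sub_one, Perm.mul_apply, ih, ← congrFun hh, Function.comp_apply,
          ← Perm.mul_apply, mul_inv_cancel, Perm.one_apply]
    obtain ⟨m, hm⟩ := hp.2
    rw [← hm, hc']
  have hd' : ∀ h : Perm α, c ∘ h = c → d h = if P h = P g then d g else 0 := by
    intro h hh
    split_ifs with hP
    · refine hd _ _ (Perm.isConj_iff_cycleType_eq.2 (Perm.cycleType_eq_of_sameCycle fun i j => ?_))
      have := Finset.ext_iff.1 hP (i, j)
      simpa [P] using this
    · exact ih _ (Finset.card_lt_card ((hcg h hh).ssubset_of_ne hP)) h rfl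
  have := hsum c
  rw [Finset.sum_congr rfl fun h hh => hd' h (Finset.mem_filter.1 hh).2, ← Finset.sum_filter,
    Finset.sum_const, nsmul_eq_mul, mul_eq_zero, Nat.cast_eq_zero, Finset.card_eq_zero] at this
  refine this.resolve_left (Finset.Nonempty.ne_empty ⟨g, ?_⟩)
  rw [Finset.mem_filter, Finset.mem_filter]
  refine ⟨⟨Finset.mem_univ _, funext fun i => (hc _ _).2 ?_⟩, rfl⟩
  exact Perm.sameCycle_apply_left.2 (Perm.SameCycle.refl g i)

end ClassFunctions

section

open MvPolynomial

section GradedIdeals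

variable {k τ M : Type*} [Field k]

/-- An ideal of a polynomial ring is graded if it contains the components of its elements. -/
def IsGradedIdeal [AddCommMonoid M] (wt : τ → M) (J : Ideal (MvPolynomial τ k)) : Prop :=
  ∀ μ, ∀ f ∈ J, weightedHomogeneousComponent wt μ f ∈ J

theorem isGradedIdeal_iff [AddCommMonoid M] [DecidableEq M] (wt : τ → M)
    (J : Ideal (MvPolynomial τ k)) :
    letI := weightedGradedAlgebra k wt
    IsGradedIdeal wt J ↔ J.IsHomogeneous (weightedHomogeneousSubmodule k wt) := by
  let := weightedGradedAlgebra k wt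
  constructor
  · intro h μ f hf
    have := h μ f hf
    rwa [← weightedDecomposition.decompose'_apply] at this
  · intro h μ f hf
    exact weightedHomogeneousComponent_mem_of_mem k wt h hf μ

theorem IsGradedIdeal.sup [AddCommMonoid M] {wt : τ → M} {I J : Ideal (MvPolynomial τ k)}
    (hI : IsGradedIdeal wt I) (hJ : IsGradedIdeal wt J) : IsGradedIdeal wt (I ⊔ J) := by
  classical
  let := weightedGradedAlgebra k wt
  exact (isGradedIdeal_iff wt _).2
    (((isGradedIdeal_iff wt _).1 hI).sup ((isGradedIdeal_iff wt _).1 hJ))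

theorem IsGradedIdeal.mul [AddCommMonoid M] {wt : τ → M} {I J : Ideal (MvPolynomial τ k)}
    (hI : IsGradedIdeal wt I) (hJ : IsGradedIdeal wt J) : IsGradedIdeal wt (I * J) := by
  classical
  let := weightedGradedAlgebra k wt
  exact (isGradedIdeal_iff wt _).2
    (((isGradedIdeal_iff wt _).1 hI).mul ((isGradedIdeal_iff wt _).1 hJ))

theorem isGradedIdeal_top [AddCommMonoid M] {wt : τ → M} :
    IsGradedIdeal wt (⊤ : Ideal (MvPolynomial τ k)) := fun _ _ _ => trivial

theorem isGradedIdeal_bot [AddCommMonoid M] {wt : τ → M} :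
    IsGradedIdeal wt (⊥ : Ideal (MvPolynomial τ k)) := by
  intro μ f hf
  rw [Ideal.mem_bot] at hf ⊢
  rw [hf, map_zero]

theorem IsGradedIdeal.prod [AddCommMonoid M] {wt : τ → M} {ι : Type*} (s : Finset ι)
    {I : ι → Ideal (MvPolynomial τ k)} (hI : ∀ i, IsGradedIdeal wt (I i)) :
    IsGradedIdeal wt (∏ i ∈ s, I i) := by
  classical
  induction s using Finset.induction_on with
  | empty => simpa using isGradedIdeal_top
  | insert a s ha ih => rw [Finset.prod_insert ha]; exact (hI a).mul ih

theorem isGradedIdeal_span [AddCommMonoid M] {wt : τ → M} (S : Set (MvPolynomial τ k))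
    (hS : ∀ s ∈ S, ∃ α, IsWeightedHomogeneous wt s α) : IsGradedIdeal wt (Ideal.span S) := by
  classical
  let := weightedGradedAlgebra k wt
  exact (isGradedIdeal_iff wt _).2 (Ideal.homogeneous_span _ _ hS)

theorem weightedHomogeneousComponent_mul_add [AddCommMonoid M] [IsLeftCancelAdd M] {wt : τ → M}
    {s : MvPolynomial τ k} {α : M} (hs : IsWeightedHomogeneous wt s α) (ν : M)
    (f : MvPolynomial τ k) :
    weightedHomogeneousComponent wt (α + ν) (s * f) =
      s * weightedHomogeneousComponent wt ν f := by
  classical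
  let := weightedGradedAlgebra k wt
  let : AddLeftCancelMonoid M :=
    { ‹AddCommMonoid M› with add_left_cancel := fun a _ _ h => add_left_cancel h }
  have := DirectSum.coe_decompose_mul_add_of_left_mem
    (𝒜 := weightedHomogeneousSubmodule k wt) (a := s) (b := f) (i := α) (j := ν) hs
  have e : ∀ (g : MvPolynomial τ k) (m : M),
    ((DirectSum.decompose (weightedHomogeneousSubmodule k wt) g) m : MvPolynomial τ k) =
      weightedHomogeneousComponent wt m g := fun g m =>
        weightedDecomposition.decompose'_apply k wt g m
  rwa [e, e] at this

/-- Homogeneous elements of the sum of a graded ideal and a principal ideal generated by a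
homogeneous element. -/
theorem exists_add_mul_of_mem_sup_span [AddCommMonoid M] [IsLeftCancelAdd M] {wt : τ → M}
    {J : Ideal (MvPolynomial τ k)} (hJ : IsGradedIdeal wt J) {x : MvPolynomial τ k} {α : M}
    (hx : IsWeightedHomogeneous wt x α) {ν : M} {f : MvPolynomial τ k}
    (hf : IsWeightedHomogeneous wt f (α + ν)) (hfJ : f ∈ J ⊔ Ideal.span {x}) :
    ∃ j ∈ J, ∃ h, IsWeightedHomogeneous wt j (α + ν) ∧ IsWeightedHomogeneous wt h ν ∧
      f = j + x * h := by
  obtain ⟨j, hj, y, hy, rfl⟩ := Submodule.mem_sup.1 hfJ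
  obtain ⟨h, rfl⟩ := Ideal.mem_span_singleton'.1 hy
  refine ⟨_, hJ (α + ν) j hj, weightedHomogeneousComponent wt ν h,
    weightedHomogeneousComponent_isWeightedHomogeneous _ _,
    weightedHomogeneousComponent_isWeightedHomogeneous _ _, ?_⟩
  rw [← weightedHomogeneousComponent_mul_add hx, ← map_add, mul_comm x]
  exact (weightedHomogeneousComponent_eq_self hf).symm

end GradedIdeals

section LinearForms

variable {k τ : Type*} [Field k]

/-- The directional derivative along a functional on the space of linear forms. -/
def dirDeriv (φ : (τ → k) →ₗ[k] k) : Derivation k (MvPolynomial τ k) (MvPolynomial τ k) :=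
  letI := Classical.decEq τ
  mkDerivation k fun i => C (φ (Pi.single i 1))

/-- The ideal `J` is closed under the directional derivative along `φ`. -/
def IsDerivClosed (φ : (τ → k) →ₗ[k] k) (J : Ideal (MvPolynomial τ k)) : Prop :=
  ∀ f ∈ J, dirDeriv φ f ∈ J

theorem IsDerivClosed.sup {φ : (τ → k) →ₗ[k] k} {I J : Ideal (MvPolynomial τ k)}
    (hI : IsDerivClosed φ I) (hJ : IsDerivClosed φ J) : IsDerivClosed φ (I ⊔ J) := by
  intro f hf
  obtain ⟨a, ha, b, hb, rfl⟩ := Submodule.mem_sup.1 hf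
  rw [map_add]
  exact Submodule.add_mem_sup (hI a ha) (hJ b hb)

theorem IsDerivClosed.mul {φ : (τ → k) →ₗ[k] k} {I J : Ideal (MvPolynomial τ k)}
    (hI : IsDerivClosed φ I) (hJ : IsDerivClosed φ J) : IsDerivClosed φ (I * J) := by
  intro f hf
  induction hf using Submodule.mul_induction_on' with
  | mem_mul_mem a ha b hb =>
    rw [Derivation.leibniz, smul_eq_mul, smul_eq_mul, mul_comm b]
    exact add_mem (Ideal.mul_mem_mul ha (hJ b hb)) (Ideal.mul_mem_mul (hI a ha) hb)
  | add a _ b _ ha hb => rw [map_add]; exact add_mem ha hb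

theorem IsDerivClosed.prod {φ : (τ → k) →ₗ[k] k} {ι : Type*} (s : Finset ι)
    {I : ι → Ideal (MvPolynomial τ k)} (hI : ∀ i ∈ s, IsDerivClosed φ (I i)) :
    IsDerivClosed φ (∏ i ∈ s, I i) := by
  classical
  induction s using Finset.induction_on with
  | empty => intro f _; simp
  | insert a s ha ih =>
    rw [Finset.prod_insert ha]
    exact (hI a (Finset.mem_insert_self _ _)).mul
      (ih fun i hi => hI i (Finset.mem_insert_of_mem hi))

theorem dirDeriv_iterate_eventually_zero (φ : (τ → k) →ₗ[k] k) (f : MvPolynomial τ k) :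
    ∃ N, ∀ n ≥ N, (dirDeriv φ)^[n] f = 0 := by
  induction f using MvPolynomial.induction_on with
  | C a =>
    refine ⟨1, fun n hn => ?_⟩
    obtain ⟨m, rfl⟩ := Nat.exists_eq_add_of_le' hn
    rw [Function.iterate_succ_apply, derivation_C, iterate_map_zero]
  | add p q hp hq =>
    obtain ⟨N, hN⟩ := hp
    obtain ⟨N', hN'⟩ := hq
    refine ⟨max N N', fun n hn => ?_⟩
    rw [iterate_map_add, hN n (le_of_max_le_left hn), hN' n (le_of_max_le_right hn), add_zero]
  | mul_X p i hp =>
    obtain ⟨N, hN⟩ := hp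
    obtain ⟨e, he⟩ : ∃ e : k, dirDeriv φ (X i) = C e := ⟨_, by rw [dirDeriv, mkDerivation_X]⟩
    have key : ∀ n, ∃ c : k, (dirDeriv φ)^[n + 1] (p * X i) =
        (dirDeriv φ)^[n + 1] p * X i + C c * (dirDeriv φ)^[n] p := by
      intro n
      induction n with
      | zero =>
        refine ⟨e, ?_⟩
        simp only [Function.iterate_succ_apply, Function.iterate_zero_apply, Derivation.leibniz,
          he, smul_eq_mul]
        ring
      | succ n ih =>
        obtain ⟨c, hc⟩ := ih
        refine ⟨e + c, ?_⟩
        rw [Function.iterate_succ_apply', hc, map_add, Derivation.leibniz, Derivation.leibniz,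
          derivation_C, ← Function.iterate_succ_apply' (dirDeriv φ),
          ← Function.iterate_succ_apply' (dirDeriv φ), he]
        simp only [smul_eq_mul, map_add]
        ring
    refine ⟨N + 1, fun n hn => ?_⟩
    obtain ⟨m, rfl⟩ := Nat.exists_eq_add_of_le' (Nat.one_le_of_lt hn)
    obtain ⟨c, hc⟩ := key m
    rw [hc, hN (m + 1) (by omega), hN m (by omega)]
    simp

variable [Fintype τ]

/-- The linear form with a given coefficient vector. -/
def linForm : (τ → k) →ₗ[k] MvPolynomial τ k :=
  Fintype.linearCombination k (fun i => (X i : MvPolynomial τ k))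

theorem linForm_apply (w : τ → k) : linForm w = ∑ i, C (w i) * X i := by
  simp [linForm, Fintype.linearCombination_apply, smul_eq_C_mul]

/-- The ideal generated by a space of linear forms. -/
def formIdeal (U : Submodule k (τ → k)) : Ideal (MvPolynomial τ k) :=
  Ideal.span (linForm '' (U : Set (τ → k)))

theorem linForm_mem_formIdeal {U : Submodule k (τ → k)} {u : τ → k} (hu : u ∈ U) :
    linForm u ∈ formIdeal U := Ideal.subset_span ⟨u, hu, rfl⟩

theorem formIdeal_span (S : Set (τ → k)) :
    formIdeal (Submodule.span k S) = Ideal.span (linForm '' S) := by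
  apply le_antisymm
  · rw [formIdeal, Ideal.span_le]
    rintro _ ⟨u, hu, rfl⟩
    induction hu using Submodule.span_induction with
    | mem x hx => exact Ideal.subset_span ⟨x, hx, rfl⟩
    | zero => simp
    | add x y _ _ hx hy => rw [map_add]; exact add_mem hx hy
    | smul a x _ hx =>
      rw [map_smul, smul_eq_C_mul]; exact Ideal.mul_mem_left _ _ hx
  · exact Ideal.span_mono (Set.image_mono Submodule.subset_span)

theorem formIdeal_mono {U U' : Submodule k (τ → k)} (h : U ≤ U') : formIdeal U ≤ formIdeal U' :=
  Ideal.span_mono (Set.image_mono h)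

theorem formIdeal_bot : formIdeal (⊥ : Submodule k (τ → k)) = ⊥ := by
  simp [formIdeal]

theorem formIdeal_sup_span (L : Submodule k (τ → k)) (x : τ → k) :
    formIdeal (L ⊔ Submodule.span k {x}) = formIdeal L ⊔ Ideal.span {linForm x} := by
  conv_lhs => rw [← Submodule.span_eq L, ← Submodule.span_union, formIdeal_span,
    Set.image_union, Ideal.span_union, Set.image_singleton]
  rfl

theorem isHomogeneous_linForm (w : τ → k) :
    IsWeightedHomogeneous (1 : τ → ℕ) (linForm w) 1 := by
  rw [linForm_apply]
  refine IsWeightedHomogeneous.sum _ _ _ fun i _ => ?_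
  exact (isWeightedHomogeneous_X k (1 : τ → ℕ) i).C_mul _

theorem isGradedIdeal_formIdeal (U : Submodule k (τ → k)) :
    IsGradedIdeal (1 : τ → ℕ) (formIdeal U) := by
  refine isGradedIdeal_span _ ?_
  rintro _ ⟨u, _, rfl⟩
  exact ⟨1, isHomogeneous_linForm u⟩

theorem mem_formIdeal_top {f : MvPolynomial τ k} {d : ℕ} (hd : d ≠ 0)
    (hf : IsWeightedHomogeneous (1 : τ → ℕ) f d) : f ∈ formIdeal (⊤ : Submodule k (τ → k)) := by
  classical
  rw [f.as_sum]
  refine Ideal.sum_mem _ fun s hs => ?_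
  have hs' := hf (mem_support_iff.1 hs)
  have hne : s ≠ 0 := by
    rintro rfl
    simp at hs'
    exact hd hs'.symm
  obtain ⟨i, hi⟩ := Finsupp.ne_iff.1 hne
  have hX : (X i : MvPolynomial τ k) ∈ formIdeal (⊤ : Submodule k (τ → k)) := by
    have : (X i : MvPolynomial τ k) = linForm (Pi.single i 1) := by
      rw [linForm_apply, Finset.sum_eq_single i]
      · simp
      · intro j _ hj; simp [hj]
      · simp
    rw [this]
    exact linForm_mem_formIdeal trivial
  have : monomial s (coeff s f) = monomial (s - Finsupp.single i 1) (coeff s f) * X i := by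
    rw [X, monomial_mul, mul_one, tsub_add_cancel_of_le]
    rw [Finsupp.single_le_iff]
    exact Nat.one_le_iff_ne_zero.2 hi
  rw [this]
  exact Ideal.mul_mem_left _ _ hX

theorem dirDeriv_linForm (φ : (τ → k) →ₗ[k] k) (w : τ → k) :
    dirDeriv φ (linForm w) = C (φ w) := by
  classical
  rw [LinearMap.pi_apply_eq_sum_univ φ w]
  simp only [linForm_apply, map_sum]
  refine Finset.sum_congr rfl fun i _ => ?_
  rw [← smul_eq_C_mul, Derivation.map_smul, dirDeriv, mkDerivation_X, smul_eq_C_mul, ← C_mul,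
    smul_eq_mul]
  congr 3
  ext j
  by_cases h : i = j
  · subst h; simp
  · simp [h, Ne.symm h]

theorem isDerivClosed_formIdeal {φ : (τ → k) →ₗ[k] k} {U : Submodule k (τ → k)}
    (h : ∀ u ∈ U, φ u = 0) : IsDerivClosed φ (formIdeal U) := by
  intro f hf
  induction hf using Submodule.span_induction with
  | mem x hx =>
    obtain ⟨u, hu, rfl⟩ := hx
    rw [dirDeriv_linForm, h u hu]; simp
  | zero => simp
  | add x y _ _ hx hy => rw [map_add]; exact add_mem hx hy
  | smul a x hx' hx =>
    rw [smul_eq_mul, Derivation.leibniz]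
    exact add_mem (Ideal.mul_mem_left _ _ hx) (Ideal.mul_mem_right _ _ hx')

/-- A linear form on which the derivative takes the value one is a nonzerodivisor modulo any ideal
closed under the derivative. -/
theorem IsDerivClosed.mem_of_mul_mem [CharZero k] {φ : (τ → k) →ₗ[k] k}
    {J : Ideal (MvPolynomial τ k)} (hJ : IsDerivClosed φ J) {x : τ → k} (hx : φ x = 1)
    {f : MvPolynomial τ k} (hf : linForm x * f ∈ J) : f ∈ J := by
  have key : ∀ (N : ℕ) (c : ℕ) (f : MvPolynomial τ k), (dirDeriv φ)^[N] f = 0 →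
      ((c + 1 : ℕ) : MvPolynomial τ k) * f + linForm x * dirDeriv φ f ∈ J → f ∈ J := by
    intro N
    induction N with
    | zero => intro c f h _; rw [Function.iterate_zero_apply] at h; simp [h]
    | succ N ih =>
      intro c f h hm
      have h1 : dirDeriv φ f ∈ J := by
        refine ih (c + 1) _ h ?_
        have := hJ _ hm
        rw [map_add, Derivation.leibniz, Derivation.leibniz, dirDeriv_linForm, hx,
          Derivation.map_natCast] at this
        convert this using 1
        simp only [smul_eq_mul]
        push_cast
        simp
        ring
      have h2 := J.sub_mem hm (J.mul_mem_left (linForm x) h1)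
      rw [add_sub_cancel_right] at h2
      have h3 := J.mul_mem_left (C (((c + 1 : ℕ) : k)⁻¹)) h2
      rwa [← mul_assoc, ← map_natCast (C : k →+* MvPolynomial τ k), ← C_mul,
        inv_mul_cancel₀ (Nat.cast_ne_zero.2 (Nat.succ_ne_zero c)), C_1, one_mul] at h3
  obtain ⟨N, hN⟩ := dirDeriv_iterate_eventually_zero φ f
  refine key N 0 f (hN N le_rfl) ?_
  have := hJ _ hf
  rw [Derivation.leibniz, dirDeriv_linForm, hx] at this
  simpa [add_comm] using this

end LinearForms

section CubeComplex

variable {ι R : Type*} [LinearOrder ι] [CommRing R]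

/-- The Koszul sign attached to inserting `j` into `Z`. -/
def cubeSign (j : ι) (Z : Finset ι) : ℤ := (-1) ^ (Z.filter (· < j)).card

theorem cubeSign_mul_self (j : ι) (Z : Finset ι) : cubeSign j Z * cubeSign j Z = 1 := by
  rw [cubeSign, ← mul_pow]; simp

theorem cubeSign_insert (j l : ι) (Z : Finset ι) (h : l ∉ Z) :
    cubeSign j (insert l Z) = (if l < j then -1 else 1) * cubeSign j Z := by
  unfold cubeSign
  rw [Finset.filter_insert]
  split_ifs with hl
  · rw [Finset.card_insert_of_notMem (by simp [h]), pow_succ]; ring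
  · simp

theorem cubeSign_swap (j l : ι) (Z : Finset ι) (hj : j ∉ Z) (hl : l ∉ Z) (h : j ≠ l) :
    cubeSign j Z * cubeSign l (insert j Z) = -(cubeSign l Z * cubeSign j (insert l Z)) := by
  rw [cubeSign_insert _ _ _ hj, cubeSign_insert _ _ _ hl]
  rcases lt_or_gt_of_ne h with h | h
  · simp [h, h.not_gt]; ring
  · simp [h, h.not_gt]; ring

/-- The contracting homotopy in direction `i` of the cube complex. -/
def cubeHomotopy (i : ι) : (Finset ι → R) →ₗ[R] (Finset ι → R) where
  toFun a Z := if i ∈ Z then cubeSign i (Z.erase i) • a (Z.erase i) else 0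
  map_add' a b := by ext Z; by_cases h : i ∈ Z <;> simp [h]
  map_smul' c a := by
    ext Z
    by_cases h : i ∈ Z
    · simp only [Pi.smul_apply, RingHom.id_apply, if_pos h]
      exact smul_comm _ _ _
    · simp [h]

theorem cubeHomotopy_apply (i : ι) (a : Finset ι → R) (Z : Finset ι) :
    cubeHomotopy i a Z = if i ∈ Z then cubeSign i (Z.erase i) • a (Z.erase i) else 0 := rfl

variable [Fintype ι]

/-- The differential of the cube complex of functions on subsets. -/
def cubeDiff : (Finset ι → R) →ₗ[R] (Finset ι → R) where
  toFun a Z := ∑ j ∈ Zᶜ, cubeSign j Z • a (insert j Z)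
  map_add' a b := by ext Z; simp [Finset.sum_add_distrib]
  map_smul' c a := by
    ext Z
    simp only [Pi.smul_apply, RingHom.id_apply, Finset.smul_sum]
    exact Finset.sum_congr rfl fun _ _ => smul_comm _ _ _

theorem cubeDiff_apply (a : Finset ι → R) (Z : Finset ι) :
    cubeDiff a Z = ∑ j ∈ Zᶜ, cubeSign j Z • a (insert j Z) := rfl

theorem cubeDiff_homotopy (i : ι) (a : Finset ι → R) :
    cubeDiff (cubeHomotopy i a) + cubeHomotopy i (cubeDiff a) = a := by
  ext Z
  rw [Pi.add_apply, cubeDiff_apply, cubeHomotopy_apply]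
  by_cases hi : i ∈ Z
  · rw [if_pos hi, cubeDiff_apply]
    have hc : (Z.erase i)ᶜ = insert i Zᶜ := by
      ext l; simp
    rw [hc, Finset.sum_insert (by simpa using hi), Finset.insert_erase hi, smul_add, smul_smul,
      cubeSign_mul_self, one_smul, add_left_comm, Finset.smul_sum, ← Finset.sum_add_distrib]
    rw [Finset.sum_eq_zero, add_zero]
    intro j hj
    rw [Finset.mem_compl] at hj
    have hij : j ≠ i := by rintro rfl; exact hj hi
    rw [cubeHomotopy_apply, if_pos (Finset.mem_insert_of_mem hi), smul_smul, smul_smul,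
      Finset.erase_insert_of_ne hij, ← add_smul]
    have hj' : j ∉ Z.erase i := fun h => hj (Finset.mem_of_mem_erase h)
    have h1 := cubeSign_swap j i (Z.erase i) hj' (by simp) hij
    rw [Finset.insert_erase hi] at h1
    have h2 : cubeSign j Z * cubeSign i (insert j (Z.erase i)) =
        - (cubeSign i (Z.erase i) * cubeSign j (Z.erase i)) := by
      have e1 := cubeSign_mul_self j Z
      have e2 := cubeSign_mul_self j (Z.erase i)
      calc _ = (cubeSign j (Z.erase i) * cubeSign j (Z.erase i)) *
            (cubeSign j Z * cubeSign i (insert j (Z.erase i))) := by rw [e2, one_mul]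
        _ = cubeSign j (Z.erase i) * cubeSign j Z *
            (cubeSign j (Z.erase i) * cubeSign i (insert j (Z.erase i))) := by ring
        _ = - (cubeSign i (Z.erase i) * cubeSign j (Z.erase i)) *
            (cubeSign j Z * cubeSign j Z) := by rw [h1]; ring
        _ = _ := by rw [e1, mul_one]
    rw [h2, neg_add_cancel, zero_smul]
  · rw [if_neg hi, add_zero, Finset.sum_eq_single i]
    · rw [cubeHomotopy_apply, if_pos (Finset.mem_insert_self _ _), Finset.erase_insert hi, smul_smul,
        cubeSign_mul_self, one_smul]
    · intro j _ hj
      rw [cubeHomotopy_apply, if_neg, smul_zero]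
      simp [hi, Ne.symm hj]
    · intro h
      simp [hi] at h

theorem cubeDiff_cubeDiff [IsDomain R] [CharZero R] (a : Finset ι → R) :
    cubeDiff (cubeDiff a) = 0 := by
  ext Z
  have e : cubeDiff (cubeDiff a) Z = ∑ j, ∑ l, if j ∉ Z ∧ l ∉ Z ∧ j ≠ l then
      (cubeSign j Z * cubeSign l (insert j Z)) • a (insert l (insert j Z)) else 0 := by
    rw [cubeDiff_apply]
    have : Zᶜ = Finset.univ.filter (fun j => j ∉ Z) := by ext; simp
    rw [this, Finset.sum_filter]
    refine Finset.sum_congr rfl fun j _ => ?_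
    by_cases hj : j ∈ Z
    · simp [hj]
    · rw [if_pos hj, cubeDiff_apply, Finset.smul_sum]
      have : (insert j Z)ᶜ = Finset.univ.filter (fun l => j ∉ Z ∧ l ∉ Z ∧ j ≠ l) := by
        ext l; simp [hj, eq_comm]; tauto
      rw [this, Finset.sum_filter]
      simp only [smul_smul]
  have e' : cubeDiff (cubeDiff a) Z = - cubeDiff (cubeDiff a) Z := by
    conv_lhs => rw [e, Finset.sum_comm]
    rw [e, ← Finset.sum_neg_distrib]
    refine Finset.sum_congr rfl fun j _ => ?_
    rw [← Finset.sum_neg_distrib]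
    refine Finset.sum_congr rfl fun l _ => ?_
    by_cases h : j ∉ Z ∧ l ∉ Z ∧ j ≠ l
    · rw [if_pos h, if_pos ⟨h.2.1, h.1, h.2.2.symm⟩, cubeSign_swap l j Z h.2.1 h.1 h.2.2.symm,
        neg_smul, Finset.insert_comm]
    · rw [if_neg h, if_neg (fun h' => h ⟨h'.2.1, h'.1, h'.2.2.symm⟩), neg_zero]
  rw [Pi.zero_apply]
  have h2 : (2 : R) * cubeDiff (cubeDiff a) Z = 0 := by
    rw [two_mul]; nth_rewrite 1 [e']; exact neg_add_cancel _
  exact (mul_eq_zero.1 h2).resolve_left two_ne_zero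

end CubeComplex

section ProductIdeals

variable {k τ ι : Type*} [Field k] [Fintype τ]

/-- The product of the ideals generated by the spaces of linear forms `U i`, for `i ∈ Y`. -/
def prodIdeal (U : ι → Submodule k (τ → k)) (Y : Finset ι) : Ideal (MvPolynomial τ k) :=
  ∏ i ∈ Y, formIdeal (U i)

theorem prodIdeal_anti (U : ι → Submodule k (τ → k)) {Y Z : Finset ι} (h : Y ⊆ Z) :
    prodIdeal U Z ≤ prodIdeal U Y := by
  classical
  rw [prodIdeal, ← Finset.sdiff_union_of_subset h, Finset.prod_union Finset.sdiff_disjoint]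
  exact (Ideal.mul_le_right : (∏ i ∈ Z \ Y, formIdeal (U i)) * (∏ i ∈ Y, formIdeal (U i)) ≤
    ∏ i ∈ Y, formIdeal (U i))

theorem prodIdeal_insert [DecidableEq ι] (U : ι → Submodule k (τ → k)) {Y : Finset ι} {i : ι}
    (h : i ∉ Y) : prodIdeal U (insert i Y) = formIdeal (U i) * prodIdeal U Y :=
  Finset.prod_insert h

theorem isGradedIdeal_prodIdeal (U : ι → Submodule k (τ → k)) (Y : Finset ι) :
    IsGradedIdeal (1 : τ → ℕ) (prodIdeal U Y) :=
  IsGradedIdeal.prod _ fun _ => isGradedIdeal_formIdeal _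

theorem linForm_mul_mem_prodIdeal_sup [DecidableEq ι] {U : ι → Submodule k (τ → k)} {Y : Finset ι}
    {I : Ideal (MvPolynomial τ k)} {i : ι} (hi : i ∈ Y) {u : τ → k} (hu : u ∈ U i)
    {f : MvPolynomial τ k} (hf : f ∈ prodIdeal U (Y.erase i) ⊔ I) :
    linForm u * f ∈ prodIdeal U Y ⊔ I := by
  obtain ⟨a, ha, b, hb, rfl⟩ := Submodule.mem_sup.1 hf
  rw [mul_add]
  refine Submodule.add_mem_sup ?_ (I.mul_mem_left _ hb)
  rw [← Finset.insert_erase hi, prodIdeal_insert U (Finset.notMem_erase i Y)]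
  exact Ideal.mul_mem_mul (linForm_mem_formIdeal hu) ha

theorem exists_functional_of_notMem {V : Type*} [AddCommGroup V] [Module k V] {S : Submodule k V}
    {x : V} (hx : x ∉ S) : ∃ φ : V →ₗ[k] k, φ x = 1 ∧ ∀ u ∈ S, φ u = 0 := by
  obtain ⟨f, hf, hf'⟩ := Submodule.exists_le_ker_of_notMem hx
  refine ⟨(f x)⁻¹ • f, by simp [hf], fun u hu => ?_⟩
  rw [LinearMap.smul_apply, LinearMap.mem_ker.1 (hf' hu), smul_zero]

/-- A form generic with respect to the subspaces spanned by the `U i` and `L`. -/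
def IsGenericForm [DecidableEq ι] (U : ι → Submodule k (τ → k)) (L : Submodule k (τ → k))
    (x : τ → k) : Prop := ∀ Z : Finset ι, Z.sup U ⊔ L ≠ ⊤ → x ∉ Z.sup U ⊔ L

omit [Fintype τ] in
theorem exists_isGenericForm [CharZero k] [Fintype ι] [DecidableEq ι]
    (U : ι → Submodule k (τ → k)) (L : Submodule k (τ → k)) : ∃ x, IsGenericForm U L x := by
  classical
  have h := Subspace.biUnion_ne_univ_of_top_notMem (k := k) (E := τ → k)
    (s := (Finset.univ.image fun Z : Finset ι => Z.sup U ⊔ L).filter (· ≠ ⊤)) (by simp)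
  obtain ⟨x, hx⟩ := (Set.ne_univ_iff_exists_notMem _).1 h
  refine ⟨x, fun Z hZ hxZ => hx ?_⟩
  simp only [Set.mem_iUnion]
  exact ⟨_, by simpa using hZ, hxZ⟩

theorem mem_prodIdeal_of_mul_mem_of_notMem [CharZero k] {U : ι → Submodule k (τ → k)}
    {L : Submodule k (τ → k)} {Y : Finset ι} {x : τ → k} (hx : x ∉ Y.sup U ⊔ L)
    {f : MvPolynomial τ k} (hf : linForm x * f ∈ prodIdeal U Y ⊔ formIdeal L) :
    f ∈ prodIdeal U Y ⊔ formIdeal L := by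
  obtain ⟨φ, h1, h0⟩ := exists_functional_of_notMem hx
  refine IsDerivClosed.mem_of_mul_mem (φ := φ) ?_ h1 hf
  refine IsDerivClosed.sup (IsDerivClosed.prod _ fun i hi => isDerivClosed_formIdeal fun u hu => ?_)
    (isDerivClosed_formIdeal fun u hu => ?_)
  · exact h0 u (le_sup_of_le_left (Finset.le_sup (f := U) hi) hu)
  · exact h0 u (Submodule.mem_sup_right hu)

/-- In high degrees, the product ideal is the intersection of the products with one factor
omitted, modulo `L`. -/
def IsLeftExact [DecidableEq ι] (U : ι → Submodule k (τ → k)) (L : Submodule k (τ → k))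
    (Y : Finset ι) : Prop :=
  Y.sup U ⊔ L = ⊤ → ∀ d ≥ Y.card, ∀ f : MvPolynomial τ k,
    IsWeightedHomogeneous (1 : τ → ℕ) f d →
    (∀ j ∈ Y, f ∈ prodIdeal U (Y.erase j) ⊔ formIdeal L) → f ∈ prodIdeal U Y ⊔ formIdeal L

theorem IsGenericForm.mem_of_mul_mem [CharZero k] [DecidableEq ι] {U : ι → Submodule k (τ → k)}
    {L : Submodule k (τ → k)} {x : τ → k} (hx : IsGenericForm U L x) {Y : Finset ι}
    (hY : ∀ Z ⊆ Y, IsLeftExact U L Z) {d : ℕ} (hd : Y.card ≤ d) {f : MvPolynomial τ k}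
    (hfd : IsWeightedHomogeneous (1 : τ → ℕ) f d)
    (hf : linForm x * f ∈ prodIdeal U Y ⊔ formIdeal L) : f ∈ prodIdeal U Y ⊔ formIdeal L := by
  induction Y using Finset.strongInduction with
  | H Y ih =>
    by_cases hs : Y.sup U ⊔ L = ⊤
    · refine hY Y subset_rfl hs d hd f hfd fun j hj => ?_
      refine ih _ (Finset.erase_ssubset hj)
        (fun Z hZ => hY Z (hZ.trans (Finset.erase_subset _ _)))
        ((Finset.card_le_card (Finset.erase_subset _ _)).trans hd) ?_
      exact sup_le_sup_right (prodIdeal_anti U (Finset.erase_subset _ _)) _ hf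
    · exact mem_prodIdeal_of_mul_mem_of_notMem (hx Y hs) hf

omit [Fintype τ] in
theorem IsGenericForm.lt_sup [DecidableEq ι] {U : ι → Submodule k (τ → k)}
    {L : Submodule k (τ → k)} {x : τ → k} (hx : IsGenericForm U L x) (hL : L ≠ ⊤) :
    L < L ⊔ Submodule.span k {x} := by
  rw [left_lt_sup, Submodule.span_singleton_le_iff_mem]
  simpa using hx ∅ (by simpa using hL)

omit [Fintype τ] in
theorem exists_sum_add_of_sup_eq_top {U : ι → Submodule k (τ → k)}
    {Y : Finset ι} {L : Submodule k (τ → k)} (hs : Y.sup U ⊔ L = ⊤) (x : τ → k) :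
    ∃ u : ι → τ → k, (∀ i ∈ Y, u i ∈ U i) ∧ ∃ l ∈ L, x = ∑ i ∈ Y, u i + l := by
  have hx : x ∈ Y.sup U ⊔ L := hs ▸ trivial
  obtain ⟨y, hy, l, hl, rfl⟩ := Submodule.mem_sup.1 hx
  rw [Finset.sup_eq_iSup, Submodule.mem_iSup_finset_iff_exists_sum] at hy
  obtain ⟨u, rfl⟩ := hy
  exact ⟨fun i => u i, fun i _ => (u i).2, l, hl, rfl⟩

theorem isLeftExact [CharZero k] [Fintype ι] [DecidableEq ι] (U : ι → Submodule k (τ → k))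
    (L : Submodule k (τ → k)) (Y : Finset ι) : IsLeftExact U L Y := by
  induction L using WellFoundedGT.induction generalizing Y with
  | ind L ihL =>
    induction Y using Finset.strongInduction with
    | H Y ihY =>
      intro hs d hd f hfd hf
      rcases Y.eq_empty_or_nonempty with rfl | hne
      · simp [prodIdeal]
      have hd0 : d ≠ 0 := by have := hne.card_pos; omega
      by_cases hL : L = ⊤
      · subst hL
        exact Ideal.mem_sup_right (mem_formIdeal_top hd0 hfd)
      obtain ⟨x, hx⟩ := exists_isGenericForm U L
      have hfx : f ∈ (prodIdeal U Y ⊔ formIdeal L) ⊔ Ideal.span {linForm x} := by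
        rw [sup_assoc, ← formIdeal_sup_span]
        refine ihL _ (hx.lt_sup hL) Y (by rw [← sup_assoc, hs, top_sup_eq]) d hd f hfd
          fun j hj => ?_
        exact sup_le_sup_left (formIdeal_mono le_sup_left) _ (hf j hj)
      obtain ⟨e, rfl⟩ := Nat.exists_eq_add_of_le (Nat.one_le_iff_ne_zero.2 hd0)
      obtain ⟨g, hg, h, -, hh, rfl⟩ := exists_add_mul_of_mem_sup_span
        ((isGradedIdeal_prodIdeal U Y).sup (isGradedIdeal_formIdeal L))
        (isHomogeneous_linForm x) hfd hfx
      refine add_mem hg ?_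
      have hhj : ∀ j ∈ Y, h ∈ prodIdeal U (Y.erase j) ⊔ formIdeal L := by
        intro j hj
        refine hx.mem_of_mul_mem
          (fun Z hZ => ihY Z (hZ.trans_ssubset (Finset.erase_ssubset hj)))
          (by rw [Finset.card_erase_of_mem hj]; omega) hh ?_
        have hg' : g ∈ prodIdeal U (Y.erase j) ⊔ formIdeal L :=
          sup_le_sup_right (prodIdeal_anti U (Finset.erase_subset _ _)) _ hg
        simpa using sub_mem (hf j hj) hg'
      obtain ⟨u, hu, l, hl, rfl⟩ := exists_sum_add_of_sup_eq_top hs x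
      rw [map_add, map_sum, add_mul, Finset.sum_mul]
      refine add_mem (sum_mem fun i hi => ?_) ?_
      · exact linForm_mul_mem_prodIdeal_sup hi (hu i hi) (hhj i hi)
      · exact Ideal.mem_sup_right (Ideal.mul_mem_right _ _ (linForm_mem_formIdeal hl))

end ProductIdeals

section CubeExactness

variable {k τ ι : Type*} [Field k] [LinearOrder ι]

theorem cubeDiff_mem [Fintype ι] {R S : Type*} [CommRing R] [SetLike S R] [AddSubgroupClass S R]
    (A : S) {a : Finset ι → R} {Z : Finset ι} (h : ∀ j ∉ Z, a (insert j Z) ∈ A) :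
    cubeDiff a Z ∈ A :=
  sum_mem fun j hj => zsmul_mem (h j (Finset.mem_compl.1 hj)) _

theorem cubeHomotopy_mem {R S : Type*} [CommRing R] [SetLike S R] [AddSubgroupClass S R]
    (A : S) {a : Finset ι → R} {Z : Finset ι} {i : ι} (h : i ∈ Z → a (Z.erase i) ∈ A) :
    cubeHomotopy i a Z ∈ A := by
  rw [cubeHomotopy_apply]
  split_ifs with hi
  · exact zsmul_mem (h hi) _
  · exact zero_mem _

variable [Fintype τ] [Fintype ι]

/-- In high degrees, the cube complex of the product ideals is exact modulo `L`. -/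
theorem exists_sub_cubeDiff_mem_formIdeal [CharZero k] [Nonempty ι] (U : ι → Submodule k (τ → k))
    (L : Submodule k (τ → k)) (hs : Finset.univ.sup U ⊔ L = ⊤) {d : ℕ} (hd : Fintype.card ι ≤ d)
    (a : Finset ι → MvPolynomial τ k)
    (had : ∀ Z, IsWeightedHomogeneous (1 : τ → ℕ) (a Z) d)
    (haJ : ∀ Z, a Z ∈ prodIdeal U Z ⊔ formIdeal L) (hda : ∀ Z, cubeDiff a Z ∈ formIdeal L) :
    ∃ e : Finset ι → MvPolynomial τ k, (∀ Z, IsWeightedHomogeneous (1 : τ → ℕ) (e Z) d) ∧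
      (∀ Z, e Z ∈ prodIdeal U Z ⊔ formIdeal L) ∧ ∀ Z, a Z - cubeDiff e Z ∈ formIdeal L := by
  induction L using WellFoundedGT.induction generalizing a d with
  | ind L ih =>
    have hd0 : d ≠ 0 := by have := Fintype.card_pos (α := ι); omega
    by_cases hL : L = ⊤
    · subst hL
      refine ⟨0, fun Z => isWeightedHomogeneous_zero _ _ _, fun Z => zero_mem _, fun Z => ?_⟩
      rw [map_zero, Pi.zero_apply, sub_zero]
      exact mem_formIdeal_top hd0 (had Z)
    obtain ⟨x, hx⟩ := exists_isGenericForm U L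
    obtain ⟨u, hu, l, hl, hxu⟩ := exists_sum_add_of_sup_eq_top hs x
    set b : Finset ι → MvPolynomial τ k := ∑ i, linForm (u i) • cubeHomotopy i a with hb
    have hbZ : ∀ Z, b Z = ∑ i, linForm (u i) * cubeHomotopy i a Z := fun Z => by
      simp [hb, Finset.sum_apply]
    have hbd : ∀ Z, IsWeightedHomogeneous (1 : τ → ℕ) (b Z) (1 + d) := by
      intro Z
      rw [hbZ]
      refine IsWeightedHomogeneous.sum _ _ _ fun i _ => (isHomogeneous_linForm _).mul ?_
      exact cubeHomotopy_mem (weightedHomogeneousSubmodule k (1 : τ → ℕ) d) fun _ => had _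
    have hbJ : ∀ Z, b Z ∈ prodIdeal U Z ⊔ formIdeal L := by
      intro Z
      rw [hbZ]
      refine sum_mem fun i _ => ?_
      rw [cubeHomotopy_apply]
      split_ifs with hi
      · rw [mul_smul_comm]
        exact zsmul_mem (linForm_mul_mem_prodIdeal_sup hi (hu i (Finset.mem_univ _)) (haJ _)) _
      · rw [mul_zero]; exact zero_mem _
    have hxab : ∀ Z, linForm x * a Z - cubeDiff b Z ∈ formIdeal L := by
      intro Z
      have h1 : cubeDiff b Z =
          ∑ i, linForm (u i) * (a Z - cubeHomotopy i (cubeDiff a) Z) := by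
        rw [hb, map_sum, Finset.sum_apply]
        refine Finset.sum_congr rfl fun i _ => ?_
        rw [map_smul, Pi.smul_apply, smul_eq_mul]
        conv_rhs => rw [← congrFun (cubeDiff_homotopy i a) Z, Pi.add_apply, add_sub_cancel_right]
      have h2 : linForm x * a Z - cubeDiff b Z =
          linForm l * a Z + ∑ i, linForm (u i) * cubeHomotopy i (cubeDiff a) Z := by
        rw [h1, hxu, map_add, map_sum]
        simp only [mul_sub, Finset.sum_sub_distrib, ← Finset.sum_mul]
        ring
      rw [h2]
      refine add_mem (Ideal.mul_mem_right _ _ (linForm_mem_formIdeal hl))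
        (sum_mem fun i _ => Ideal.mul_mem_left _ _ ?_)
      exact cubeHomotopy_mem _ fun _ => hda _
    have hLx : formIdeal L ≤ formIdeal (L ⊔ Submodule.span k {x}) := formIdeal_mono le_sup_left
    have hxL : linForm x ∈ formIdeal (L ⊔ Submodule.span k {x}) :=
      linForm_mem_formIdeal (Submodule.mem_sup_right (Submodule.mem_span_singleton_self x))
    obtain ⟨c, hcd, hcJ, hc⟩ := ih _ (hx.lt_sup hL) (by rw [← sup_assoc, hs, top_sup_eq])
      (d := 1 + d) (by omega) b hbd (fun Z => sup_le_sup_left hLx _ (hbJ Z)) (by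
        intro Z
        have := sub_mem (Ideal.mul_mem_right (a Z) _ hxL) (hLx (hxab Z))
        rwa [sub_sub_cancel] at this)
    have hcs : ∀ Z, ∃ j ∈ prodIdeal U Z ⊔ formIdeal L, ∃ h,
        IsWeightedHomogeneous (1 : τ → ℕ) j (1 + d) ∧
        IsWeightedHomogeneous (1 : τ → ℕ) h d ∧ c Z = j + linForm x * h := by
      intro Z
      refine exists_add_mul_of_mem_sup_span
        ((isGradedIdeal_prodIdeal U Z).sup (isGradedIdeal_formIdeal L))
        (isHomogeneous_linForm x) (hcd Z) ?_
      rw [sup_assoc, ← formIdeal_sup_span]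
      exact hcJ Z
    choose j hjJ h hjd hhd hcjh using hcs
    have hcj : c = j + linForm x • h := funext hcjh
    have hes : ∀ Z, ∃ l ∈ formIdeal L, ∃ e,
        IsWeightedHomogeneous (1 : τ → ℕ) l (1 + d) ∧
        IsWeightedHomogeneous (1 : τ → ℕ) e d ∧ b Z - cubeDiff j Z = l + linForm x * e := by
      intro Z
      refine exists_add_mul_of_mem_sup_span (isGradedIdeal_formIdeal L)
        (isHomogeneous_linForm x) ?_ ?_
      · exact sub_mem (S := Submodule k (MvPolynomial τ k)) (hbd Z)
          (cubeDiff_mem (weightedHomogeneousSubmodule k (1 : τ → ℕ) (1 + d)) fun _ _ => hjd _)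
      · rw [← formIdeal_sup_span]
        have := add_mem (hc Z) (Ideal.mul_mem_right (cubeDiff h Z) _ hxL)
        rw [hcj, map_add, map_smul, Pi.add_apply, Pi.smul_apply, smul_eq_mul] at this
        convert this using 1
        ring
    choose l' hl'L e hl'd hed hbe using hes
    refine ⟨e, hed, fun Z => ?_, fun Z => ?_⟩
    · refine hx.mem_of_mul_mem (fun Z _ => isLeftExact U L Z)
        ((Finset.card_le_univ Z).trans hd) (hed Z) ?_
      have h1 : cubeDiff j Z ∈ prodIdeal U Z ⊔ formIdeal L := cubeDiff_mem _ fun i _ =>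
        sup_le_sup_right (prodIdeal_anti U (Finset.subset_insert _ _)) _ (hjJ _)
      have h2 := sub_mem (sub_mem (hbJ Z) h1) (Ideal.mem_sup_right (hl'L Z))
      rwa [hbe Z, add_sub_cancel_left] at h2
    · have hxnL : x ∉ L := by simpa using hx ∅ (by simpa using hL)
      obtain ⟨φ, h1, h0⟩ := exists_functional_of_notMem hxnL
      refine (isDerivClosed_formIdeal h0).mem_of_mul_mem h1 ?_
      have hbe' : b = cubeDiff j + (l' + linForm x • e) := by
        funext Z
        have := hbe Z
        rw [sub_eq_iff_eq_add'] at this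
        exact this
      have h2 : cubeDiff b Z = cubeDiff l' Z + linForm x * cubeDiff e Z := by
        rw [hbe', map_add, cubeDiff_cubeDiff, zero_add, map_add, map_smul]
        rfl
      have h3 := add_mem (hxab Z) (cubeDiff_mem (formIdeal L) fun i _ => hl'L (insert i Z))
      rw [h2] at h3
      convert h3 using 1
      ring

/-- The homogeneous piece of an ideal. -/
def gradedPiece {M : Type*} [AddCommMonoid M] (wt : τ → M) (J : Ideal (MvPolynomial τ k)) (μ : M) :
    Submodule k (MvPolynomial τ k) :=
  J.restrictScalars k ⊓ weightedHomogeneousSubmodule k wt μ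

omit [Fintype τ] in
theorem mem_gradedPiece {M : Type*} [AddCommMonoid M] {wt : τ → M} {J : Ideal (MvPolynomial τ k)}
    {μ : M} {f : MvPolynomial τ k} :
    f ∈ gradedPiece wt J μ ↔ f ∈ J ∧ IsWeightedHomogeneous wt f μ := Iff.rfl

omit [Fintype τ] in
theorem IsWeightedHomogeneous.map_weight {M N : Type*} [AddCommMonoid M] [AddCommMonoid N]
    {wt : τ → M} (δ : M →+ N) {f : MvPolynomial τ k} {μ : M}
    (hf : IsWeightedHomogeneous wt f μ) : IsWeightedHomogeneous (δ ∘ wt) f (δ μ) := by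
  intro s hs
  rw [← hf hs, Finsupp.weight_apply, Finsupp.weight_apply, Finsupp.sum, Finsupp.sum, map_sum]
  simp

theorem exists_cubeDiff_eq [CharZero k] [Nonempty ι] {M : Type*} [AddCommMonoid M] {wt : τ → M}
    (δ : M →+ ℕ) (hδ : δ ∘ wt = 1) {U : ι → Submodule k (τ → k)}
    {L : Submodule k (τ → k)} (hU : ∀ Z, IsGradedIdeal wt (prodIdeal U Z))
    (hL : IsGradedIdeal wt (formIdeal L)) (hs : Finset.univ.sup U ⊔ L = ⊤) {μ : M}
    (hμ : Fintype.card ι ≤ δ μ) (a : Finset ι → MvPolynomial τ k)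
    (ha : ∀ Z, a Z ∈ gradedPiece wt (prodIdeal U Z ⊔ formIdeal L) μ) (hda : cubeDiff a = 0) :
    ∃ b : Finset ι → MvPolynomial τ k,
      (∀ Z, b Z ∈ gradedPiece wt (prodIdeal U Z ⊔ formIdeal L) μ) ∧ cubeDiff b = a := by
  obtain ⟨e, -, heJ, he⟩ := exists_sub_cubeDiff_mem_formIdeal U L hs hμ a
    (fun Z => hδ ▸ IsWeightedHomogeneous.map_weight δ (ha Z).2) (fun Z => (ha Z).1)
    (fun Z => by rw [hda]; exact zero_mem _)
  obtain ⟨i⟩ := ‹Nonempty ι›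
  set l := a - cubeDiff e with hl
  have hdl : cubeDiff l = 0 := by rw [hl, map_sub, hda, cubeDiff_cubeDiff, sub_zero]
  have hhl := cubeDiff_homotopy i l
  rw [hdl, map_zero, add_zero] at hhl
  refine ⟨fun Z => weightedHomogeneousComponent wt μ ((e + cubeHomotopy i l) Z), fun Z => ⟨?_, ?_⟩,
    ?_⟩
  · refine (hU Z).sup hL _ _ (add_mem (heJ Z) (Ideal.mem_sup_right ?_))
    exact cubeHomotopy_mem _ fun _ => he _
  · exact weightedHomogeneousComponent_isWeightedHomogeneous _ _
  · have h1 : cubeDiff (e + cubeHomotopy i l) = a := by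
      rw [map_add, hhl, hl, add_sub_cancel]
    funext Z
    rw [← weightedHomogeneousComponent_eq_self (ha Z).2, ← h1, cubeDiff_apply, cubeDiff_apply,
      map_sum]
    exact Finset.sum_congr rfl fun j _ => (map_zsmul _ _ _).symm

end CubeExactness

section EulerCharacteristic

variable {k ι R : Type*} [Field k] [LinearOrder ι] [Fintype ι] [CommRing R] [Algebra k R]

/-- The submodule of families with values in given submodules is their product. -/
def piSubmoduleEquiv {κ V : Type*} [AddCommGroup V] [Module k V] (p : κ → Submodule k V) :
    Submodule.pi Set.univ p ≃ₗ[k] ∀ i, p i where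
  toFun a i := ⟨a.1 i, a.2 i trivial⟩
  invFun a := ⟨fun i => a i, fun i _ => (a i).2⟩
  map_add' _ _ := rfl
  map_smul' _ _ := rfl

/-- Families of elements of the `A Z` supported on the sets satisfying `P`. -/
def supportedFamilies (A : Finset ι → Submodule k R) (P : Finset ι → Prop) [DecidablePred P] :
    Submodule k (Finset ι → R) :=
  Submodule.pi Set.univ fun Z => if P Z then A Z else ⊥

theorem map_cubeDiff_supportedFamilies [IsDomain R] [CharZero R] {A : Finset ι → Submodule k R}
    (hA : ∀ Y Z, Y ⊆ Z → A Z ≤ A Y)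
    (hex : ∀ a : Finset ι → R, (∀ Z, a Z ∈ A Z) → cubeDiff a = 0 →
      ∃ b : Finset ι → R, (∀ Z, b Z ∈ A Z) ∧ cubeDiff b = a)
    (P Q : Finset ι → Prop) [DecidablePred P] [DecidablePred Q]
    (hPQ : ∀ Z, ∀ j ∉ Z, (P (insert j Z) ↔ Q Z)) :
    (supportedFamilies A P).map (cubeDiff.restrictScalars k) =
      supportedFamilies A Q ⊓ LinearMap.ker (cubeDiff.restrictScalars k) := by
  apply le_antisymm
  · rintro _ ⟨b, hb, rfl⟩
    refine ⟨fun Z _ => ?_, ?_⟩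
    · refine cubeDiff_mem (if Q Z then A Z else ⊥) fun j hj => ?_
      have := hb (insert j Z) trivial
      simp only [hPQ Z j hj] at this
      split_ifs at this ⊢ with h
      · exact hA _ _ (Finset.subset_insert _ _) this
      · exact this
    · exact cubeDiff_cubeDiff b
  · rintro a ⟨ha, hda⟩
    obtain ⟨b, hbA, hb⟩ := hex a (fun Z => by
      have := ha Z trivial
      dsimp only at this
      split_ifs at this
      · exact this
      · rw [(Submodule.mem_bot k).1 this]; exact zero_mem _) hda
    refine ⟨fun Z => if P Z then b Z else 0, fun Z _ => ?_, ?_⟩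
    · dsimp only
      split_ifs
      · exact hbA Z
      · exact zero_mem _
    · funext Z
      change cubeDiff _ Z = a Z
      by_cases h : Q Z
      · rw [← hb, cubeDiff_apply, cubeDiff_apply]
        refine Finset.sum_congr rfl fun j hj => ?_
        rw [if_pos ((hPQ Z j (Finset.mem_compl.1 hj)).2 h)]
      · have := ha Z trivial
        dsimp only at this
        rw [if_neg h] at this
        rw [(Submodule.mem_bot k).1 this, cubeDiff_apply]
        refine Finset.sum_eq_zero fun j hj => ?_
        rw [if_neg (mt (hPQ Z j (Finset.mem_compl.1 hj)).1 h), smul_zero]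

theorem sum_neg_one_pow_finrank_eq_zero [IsDomain R] [CharZero R] (A : Finset ι → Submodule k R)
    [∀ Z, FiniteDimensional k (A Z)] (hA : ∀ Y Z, Y ⊆ Z → A Z ≤ A Y)
    (hex : ∀ a : Finset ι → R, (∀ Z, a Z ∈ A Z) → cubeDiff a = 0 →
      ∃ b : Finset ι → R, (∀ Z, b Z ∈ A Z) ∧ cubeDiff b = a) :
    ∑ Z : Finset ι, (-1 : ℤ) ^ Z.card * Module.finrank k (A Z) = 0 := by
  have hfin : ∀ (P : Finset ι → Prop) [DecidablePred P] (Z : Finset ι),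
      FiniteDimensional k ↥(if P Z then A Z else ⊥) := by
    intro P _ Z
    by_cases h : P Z
    · rw [if_pos h]; infer_instance
    · rw [if_neg h]; infer_instance
  have rn : ∀ (P : Finset ι → Prop) [DecidablePred P],
      Module.finrank k ((supportedFamilies A P).map (cubeDiff.restrictScalars k)) +
        Module.finrank k ↥(supportedFamilies A P ⊓
          LinearMap.ker (cubeDiff.restrictScalars k)) =
      ∑ Z, if P Z then Module.finrank k (A Z) else 0 := by
    intro P _
    have := hfin P
    have h1 : FiniteDimensional k (supportedFamilies A P) := (piSubmoduleEquiv _).symm.finiteDimensional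
    have h2 := ((cubeDiff.restrictScalars k : (Finset ι → R) →ₗ[k] _).domRestrict
      (supportedFamilies A P)).finrank_range_add_finrank_ker
    rw [LinearMap.range_domRestrict, LinearMap.ker_domRestrict] at h2
    have h3 : Module.finrank k (supportedFamilies A P) =
        ∑ Z, if P Z then Module.finrank k (A Z) else 0 := by
      rw [supportedFamilies, (piSubmoduleEquiv _).finrank_eq, Module.finrank_pi_fintype]
      refine Finset.sum_congr rfl fun Z _ => ?_
      by_cases h : P Z
      · rw [if_pos h, if_pos h]
      · rw [if_neg h, if_neg h, finrank_bot]
    rw [← h3, ← h2]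
    rw [← Submodule.map_comap_subtype, Submodule.finrank_map_subtype_eq]
  have h1 := rn fun Z => Even Z.card
  have h2 := rn fun Z => ¬ Even Z.card
  rw [map_cubeDiff_supportedFamilies hA hex (fun Z => Even Z.card) (fun Z => ¬ Even Z.card)
    (fun Z j hj => by rw [Finset.card_insert_of_notMem hj, Nat.even_add_one])] at h1
  rw [map_cubeDiff_supportedFamilies hA hex (fun Z => ¬ Even Z.card) (fun Z => Even Z.card)
    (fun Z j hj => by rw [Finset.card_insert_of_notMem hj, Nat.even_add_one, not_not]),
    add_comm, h1] at h2
  have h3 : ∑ Z : Finset ι, (-1 : ℤ) ^ Z.card * Module.finrank k (A Z) =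
      ((∑ Z, if Even Z.card then Module.finrank k (A Z) else 0 : ℕ) : ℤ) -
      ((∑ Z, if ¬ Even Z.card then Module.finrank k (A Z) else 0 : ℕ) : ℤ) := by
    push_cast
    rw [← Finset.sum_sub_distrib]
    refine Finset.sum_congr rfl fun Z _ => ?_
    by_cases h : Even Z.card
    · simp [h]
    · simp [h, (Nat.not_even_iff_odd.1 h).neg_one_pow]
  rw [h3, h2, sub_self]

end EulerCharacteristic

section GradedPieces

variable {k τ κ : Type*} [Field k] [Fintype τ] {wt : τ → κ →₀ ℕ}

omit [Fintype τ] in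
theorem mem_gradedPiece_top {f : MvPolynomial τ k} {μ : κ →₀ ℕ} :
    f ∈ gradedPiece wt (⊤ : Ideal (MvPolynomial τ k)) μ ↔ IsWeightedHomogeneous wt f μ :=
  mem_gradedPiece.trans (and_iff_right Submodule.mem_top)

theorem linForm_ne_zero_of_apply_eq_one {φ : (τ → k) →ₗ[k] k} {x : τ → k}
    (hx : φ x = 1) : linForm x ≠ 0 := by
  intro h
  have := dirDeriv_linForm φ x
  rw [h, map_zero, hx] at this
  simp at this

theorem finiteDimensional_gradedPiece (hwt : Finsupp.degree ∘ wt = 1)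
    (J : Ideal (MvPolynomial τ k)) (μ : κ →₀ ℕ) : FiniteDimensional k (gradedPiece wt J μ) := by
  have h1 : FiniteDimensional k
      (weightedHomogeneousSubmodule k (1 : τ → ℕ) (Finsupp.degree μ)) :=
    Module.Finite.iff_fg.2 (weightedHomogeneousSubmodule_fg k _ (by simp) _)
  refine Submodule.finiteDimensional_of_le
    (S₂ := weightedHomogeneousSubmodule k (1 : τ → ℕ) (Finsupp.degree μ)) ?_
  intro f hf
  exact hwt ▸ IsWeightedHomogeneous.map_weight Finsupp.degree hf.2

theorem finrank_gradedPiece_sup_span [CharZero k] (hwt : Finsupp.degree ∘ wt = 1)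
    {J : Ideal (MvPolynomial τ k)} (hJ : IsGradedIdeal wt J) {ψ : (τ → k) →ₗ[k] k}
    (hψ : IsDerivClosed ψ J) {x : τ → k} (hx : ψ x = 1) {α : κ →₀ ℕ}
    (hxα : IsWeightedHomogeneous wt (linForm x) α) (ν : κ →₀ ℕ) :
    Module.finrank k (gradedPiece wt (J ⊔ Ideal.span {linForm x}) (α + ν)) +
      Module.finrank k (gradedPiece wt J ν) =
    Module.finrank k (gradedPiece wt J (α + ν)) +
      Module.finrank k (gradedPiece wt (⊤ : Ideal (MvPolynomial τ k)) ν) := by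
  have hfin := finiteDimensional_gradedPiece (k := k) hwt
  obtain ⟨T, hT⟩ : ∃ T : MvPolynomial τ k →ₗ[k] MvPolynomial τ k, ∀ h, T h = linForm x * h :=
    ⟨LinearMap.mulLeft k (linForm x), fun _ => rfl⟩
  have hinj : Function.Injective T := by
    intro a b h
    rw [hT, hT] at h
    exact mul_left_cancel₀ (linForm_ne_zero_of_apply_eq_one hx) h
  have hrank : ∀ S : Submodule k (MvPolynomial τ k),
      Module.finrank k (S.map T) = Module.finrank k S := fun S =>
    (Submodule.equivMapOfInjective T hinj S).finrank_eq.symm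
  have h1 : gradedPiece wt (J ⊔ Ideal.span {linForm x}) (α + ν) =
      gradedPiece wt J (α + ν) ⊔ (gradedPiece wt (⊤ : Ideal (MvPolynomial τ k)) ν).map T := by
    apply le_antisymm
    · intro f hf
      rw [mem_gradedPiece] at hf
      obtain ⟨j, hj, h, hjd, hhd, rfl⟩ := exists_add_mul_of_mem_sup_span hJ hxα hf.2 hf.1
      rw [← hT]
      exact Submodule.add_mem_sup (mem_gradedPiece.2 ⟨hj, hjd⟩)
        (Submodule.mem_map_of_mem (mem_gradedPiece_top.2 hhd))
    · refine sup_le (fun f hf => ⟨Ideal.mem_sup_left hf.1, hf.2⟩) ?_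
      intro f hf
      obtain ⟨h, hh, rfl⟩ := Submodule.mem_map.1 hf
      rw [mem_gradedPiece] at hh
      rw [mem_gradedPiece, hT]
      exact ⟨Ideal.mem_sup_right (Ideal.mul_mem_right _ _ (Ideal.mem_span_singleton_self _)),
        hxα.mul hh.2⟩
  have h2 : gradedPiece wt J (α + ν) ⊓ (gradedPiece wt (⊤ : Ideal (MvPolynomial τ k)) ν).map T =
      (gradedPiece wt J ν).map T := by
    apply le_antisymm
    · intro f hf
      obtain ⟨hf, h, hh, rfl⟩ := hf
      rw [SetLike.mem_coe, mem_gradedPiece] at hh hf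
      rw [hT] at hf
      exact Submodule.mem_map_of_mem (mem_gradedPiece.2 ⟨hψ.mem_of_mul_mem hx hf.1, hh.2⟩)
    · intro f hf
      obtain ⟨h, hh, rfl⟩ := Submodule.mem_map.1 hf
      rw [mem_gradedPiece] at hh
      refine ⟨?_, Submodule.mem_map_of_mem (mem_gradedPiece_top.2 hh.2)⟩
      rw [hT]
      exact ⟨J.mul_mem_left _ hh.1, hxα.mul hh.2⟩
  have h3 := Submodule.finrank_sup_add_finrank_inf_eq (gradedPiece wt J (α + ν))
    ((gradedPiece wt (⊤ : Ideal (MvPolynomial τ k)) ν).map T)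
  rw [← h1, h2, hrank, hrank] at h3
  exact h3

omit [Fintype τ] in
theorem gradedPiece_sup_span_of_not_le {J : Ideal (MvPolynomial τ k)} (hJ : IsGradedIdeal wt J)
    {x : MvPolynomial τ k} {α : κ →₀ ℕ} (hxα : IsWeightedHomogeneous wt x α) {μ : κ →₀ ℕ}
    (hμ : ¬ α ≤ μ) : gradedPiece wt (J ⊔ Ideal.span {x}) μ = gradedPiece wt J μ := by
  classical
  apply le_antisymm
  · rintro f ⟨hf, hfd⟩
    refine ⟨?_, hfd⟩
    obtain ⟨j, hj, y, hy, rfl⟩ := Submodule.mem_sup.1 hf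
    obtain ⟨h, rfl⟩ := Ideal.mem_span_singleton'.1 hy
    have h0 : weightedHomogeneousComponent wt μ (x * h) = 0 := by
      let := weightedGradedAlgebra k wt
      have := DirectSum.coe_decompose_mul_of_left_mem_of_not_le
        (𝒜 := weightedHomogeneousSubmodule k wt) (a := x) (b := h) (i := α) (n := μ) hxα hμ
      rwa [← weightedDecomposition.decompose'_apply]
    rw [← weightedHomogeneousComponent_eq_self hfd, map_add, mul_comm h, h0, add_zero]
    exact hJ _ _ hj
  · exact fun f hf => ⟨Ideal.mem_sup_left hf.1, hf.2⟩

/-- Two ideals with the same multigraded Hilbert function. -/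
def SameHilbert (wt : τ → κ →₀ ℕ) (J J' : Ideal (MvPolynomial τ k)) : Prop :=
  ∀ μ, Module.finrank k (gradedPiece wt J μ) = Module.finrank k (gradedPiece wt J' μ)

theorem sameHilbert_sup_span_iff [CharZero k] (hwt : Finsupp.degree ∘ wt = 1)
    {J J' : Ideal (MvPolynomial τ k)} (hJ : IsGradedIdeal wt J) (hJ' : IsGradedIdeal wt J')
    {ψ ψ' : (τ → k) →ₗ[k] k} (hψ : IsDerivClosed ψ J) (hψ' : IsDerivClosed ψ' J')
    {x x' : τ → k} (hx : ψ x = 1) (hx' : ψ' x' = 1) {c : κ}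
    (hxc : IsWeightedHomogeneous wt (linForm x) (Finsupp.single c 1))
    (hxc' : IsWeightedHomogeneous wt (linForm x') (Finsupp.single c 1)) :
    SameHilbert wt J J' ↔
      SameHilbert wt (J ⊔ Ideal.span {linForm x}) (J' ⊔ Ideal.span {linForm x'}) := by
  have hnot : ∀ μ : κ →₀ ℕ, μ c = 0 → ¬ Finsupp.single c 1 ≤ μ := by
    intro μ hμ h
    have := h c
    rw [Finsupp.single_eq_same, hμ] at this
    omega
  have hsub : ∀ μ : κ →₀ ℕ, μ c ≠ 0 → μ = Finsupp.single c 1 + (μ - Finsupp.single c 1) := by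
    intro μ hμ
    refine (add_tsub_cancel_of_le ?_).symm
    rw [Finsupp.single_le_iff]
    omega
  constructor
  · intro h μ
    by_cases hμ : μ c = 0
    · rw [gradedPiece_sup_span_of_not_le hJ hxc (hnot μ hμ),
        gradedPiece_sup_span_of_not_le hJ' hxc' (hnot μ hμ), h μ]
    · rw [hsub μ hμ]
      have h1 := finrank_gradedPiece_sup_span hwt hJ hψ hx hxc (μ - Finsupp.single c 1)
      have h2 := finrank_gradedPiece_sup_span hwt hJ' hψ' hx' hxc' (μ - Finsupp.single c 1)
      rw [h, h] at h1
      omega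
  · intro h μ
    induction hm : μ c generalizing μ with
    | zero =>
      have := h μ
      rwa [gradedPiece_sup_span_of_not_le hJ hxc (hnot μ hm),
        gradedPiece_sup_span_of_not_le hJ' hxc' (hnot μ hm)] at this
    | succ m ih =>
      have ih' := ih (μ - Finsupp.single c 1) (by simp [hm])
      rw [hsub μ (by omega)]
      have h1 := finrank_gradedPiece_sup_span hwt hJ hψ hx hxc (μ - Finsupp.single c 1)
      have h2 := finrank_gradedPiece_sup_span hwt hJ' hψ' hx' hxc' (μ - Finsupp.single c 1)
      rw [h, ih'] at h1
      omega

end GradedPieces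

section ColouredForms

variable {k κ : Type*} [Field k] {r : ℕ}

/-- The multidegree of a coloured variable. -/
def colourWeight (r : ℕ) (κ : Type*) : Fin r × κ → κ →₀ ℕ := fun p => Finsupp.single p.2 1

theorem degree_comp_colourWeight : Finsupp.degree ∘ colourWeight r κ = 1 := by
  ext p
  simp [colourWeight]

/-- The vector `b` placed in the colour `c`. -/
def colourVec [DecidableEq κ] (b : Fin r → k) (c : κ) : Fin r × κ → k :=
  fun p => if p.2 = c then b p.1 else 0

/-- The functional `φ` applied to the part of colour `c`. -/
def colourFunctional (φ : (Fin r → k) →ₗ[k] k) (c : κ) : (Fin r × κ → k) →ₗ[k] k :=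
  φ ∘ₗ LinearMap.funLeft k k fun a => (a, c)

theorem colourFunctional_colourVec [DecidableEq κ] (φ : (Fin r → k) →ₗ[k] k) (c d : κ)
    (b : Fin r → k) : colourFunctional φ c (colourVec b d) = if c = d then φ b else 0 := by
  have : colourFunctional φ c (colourVec b d) = φ fun a => if c = d then b a else 0 := rfl
  rw [this]
  split_ifs
  · rfl
  · exact map_zero φ

/-- The span of the copies of `b` in all colours. -/
def colourSpace [DecidableEq κ] (b : Fin r → k) : Submodule k (Fin r × κ → k) :=
  Submodule.span k (Set.range (colourVec b))

variable [Fintype κ] [DecidableEq κ]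

theorem isWeightedHomogeneous_linForm_colourVec (b : Fin r → k) (c : κ) :
    IsWeightedHomogeneous (colourWeight r κ) (linForm (colourVec b c)) (Finsupp.single c 1) := by
  rw [linForm_apply]
  refine IsWeightedHomogeneous.sum _ _ _ fun p _ => ?_
  by_cases h : p.2 = c
  · have := isWeightedHomogeneous_X k (colourWeight r κ) p
    rw [colourWeight, h] at this
    exact this.C_mul _
  · rw [colourVec, if_neg h, C_0, zero_mul]
    exact isWeightedHomogeneous_zero _ _ _

theorem isGradedIdeal_formIdeal_span_colourVec {S : Set (Fin r × κ → k)}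
    (hS : ∀ u ∈ S, ∃ b c, u = colourVec b c) :
    IsGradedIdeal (colourWeight r κ) (formIdeal (Submodule.span k S)) := by
  rw [formIdeal_span]
  refine isGradedIdeal_span _ ?_
  rintro _ ⟨u, hu, rfl⟩
  obtain ⟨b, c, rfl⟩ := hS u hu
  exact ⟨_, isWeightedHomogeneous_linForm_colourVec b c⟩

theorem isGradedIdeal_prodIdeal_colourSpace {ι : Type*} (v : ι → Fin r → k) (Y : Finset ι) :
    IsGradedIdeal (colourWeight r κ) (prodIdeal (fun i => colourSpace (κ := κ) (v i)) Y) := by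
  refine IsGradedIdeal.prod _ fun i => isGradedIdeal_formIdeal_span_colourVec ?_
  rintro _ ⟨c, rfl⟩
  exact ⟨_, _, rfl⟩

theorem isDerivClosed_colourSpace {φ : (Fin r → k) →ₗ[k] k} {b : Fin r → k} (h : φ b = 0) (c : κ) :
    IsDerivClosed (colourFunctional φ c) (formIdeal (colourSpace (κ := κ) b)) := by
  refine isDerivClosed_formIdeal fun u hu => ?_
  induction hu using Submodule.span_induction with
  | mem u hu =>
    obtain ⟨d, rfl⟩ := hu
    rw [colourFunctional_colourVec, h, ite_self]
  | zero => exact map_zero _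
  | add x y _ _ hx hy => rw [map_add, hx, hy, add_zero]
  | smul a x _ hx => rw [map_smul, hx, smul_zero]

/-- The span of a family of coloured vectors. -/
def colouredSpan {m : ℕ} (B : Fin m → Fin r → k) (P : Finset (Fin m × κ)) :
    Submodule k (Fin r × κ → k) :=
  Submodule.span k ((fun p : Fin m × κ => colourVec (B p.1) p.2) '' P)

theorem isGradedIdeal_colouredSpan {m : ℕ} (B : Fin m → Fin r → k) (P : Finset (Fin m × κ)) :
    IsGradedIdeal (colourWeight r κ) (formIdeal (colouredSpan B P)) := by
  refine isGradedIdeal_formIdeal_span_colourVec ?_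
  rintro _ ⟨p, -, rfl⟩
  exact ⟨_, _, rfl⟩

theorem isDerivClosed_colouredSpan {m : ℕ} {B : Fin m → Fin r → k}
    {φ : Fin m → (Fin r → k) →ₗ[k] k} (hφ : ∀ s t, φ s (B t) = if s = t then 1 else 0)
    {P : Finset (Fin m × κ)} {p : Fin m × κ} (hp : p ∉ P) :
    IsDerivClosed (colourFunctional (φ p.1) p.2) (formIdeal (colouredSpan B P)) := by
  refine isDerivClosed_formIdeal fun u hu => ?_
  induction hu using Submodule.span_induction with
  | mem u hu =>
    obtain ⟨q, hq, rfl⟩ := hu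
    rw [colourFunctional_colourVec, hφ]
    split_ifs with h1 h2
    · exact absurd (Prod.ext h2 h1 ▸ hq) hp
    · rfl
    · rfl
  | zero => exact map_zero _
  | add x y _ _ hx hy => rw [map_add, hx, hy, add_zero]
  | smul a x _ hx => rw [map_smul, hx, smul_zero]

theorem sameHilbert_sup_colouredSpan_iff [CharZero k] {J J' : Ideal (MvPolynomial (Fin r × κ) k)}
    (hJ : IsGradedIdeal (colourWeight r κ) J) (hJ' : IsGradedIdeal (colourWeight r κ) J') {m : ℕ}
    {B B' : Fin m → Fin r → k} {φ φ' : Fin m → (Fin r → k) →ₗ[k] k}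
    (hφ : ∀ s t, φ s (B t) = if s = t then 1 else 0)
    (hφ' : ∀ s t, φ' s (B' t) = if s = t then 1 else 0)
    (hd : ∀ s c, IsDerivClosed (colourFunctional (φ s) c) J)
    (hd' : ∀ s c, IsDerivClosed (colourFunctional (φ' s) c) J') (P : Finset (Fin m × κ)) :
    SameHilbert (colourWeight r κ) J J' ↔
      SameHilbert (colourWeight r κ) (J ⊔ formIdeal (colouredSpan B P))
        (J' ⊔ formIdeal (colouredSpan B' P)) := by
  induction P using Finset.induction_on with
  | empty => simp [colouredSpan, formIdeal_bot]
  | insert p P hp ih =>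
    have hins : ∀ B : Fin m → Fin r → k, formIdeal (colouredSpan B (insert p P)) =
        formIdeal (colouredSpan B P) ⊔ Ideal.span {linForm (colourVec (B p.1) p.2)} := by
      intro B
      rw [← formIdeal_sup_span, colouredSpan, Finset.coe_insert, Set.image_insert_eq,
        Submodule.span_insert, sup_comm]
      rfl
    rw [ih, hins, hins, ← sup_assoc, ← sup_assoc]
    exact sameHilbert_sup_span_iff degree_comp_colourWeight
      (hJ.sup (isGradedIdeal_colouredSpan B P)) (hJ'.sup (isGradedIdeal_colouredSpan B' P))
      ((hd p.1 p.2).sup (isDerivClosed_colouredSpan hφ hp))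
      ((hd' p.1 p.2).sup (isDerivClosed_colouredSpan hφ' hp))
      (by rw [colourFunctional_colourVec, if_pos rfl, hφ, if_pos rfl])
      (by rw [colourFunctional_colourVec, if_pos rfl, hφ', if_pos rfl])
      (isWeightedHomogeneous_linForm_colourVec _ _) (isWeightedHomogeneous_linForm_colourVec _ _)

theorem prodIdeal_le_pow_idealOfVars {ι τ : Type*} [Fintype τ] (U : ι → Submodule k (τ → k))
    (Y : Finset ι) : prodIdeal U Y ≤ idealOfVars τ k ^ Y.card := by
  rw [prodIdeal, ← Finset.prod_const]
  refine Finset.prod_le_prod' fun i _ => Ideal.span_le.2 ?_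
  rintro _ ⟨u, -, rfl⟩
  rw [linForm_apply]
  exact sum_mem fun p _ => Ideal.mul_mem_left _ _ (Ideal.subset_span ⟨p, rfl⟩)

theorem gradedPiece_prodIdeal_sup_of_lt {ι : Type*} (v : ι → Fin r → k) (Y : Finset ι)
    {I : Ideal (MvPolynomial (Fin r × κ) k)} (hI : IsGradedIdeal (colourWeight r κ) I)
    {μ : κ →₀ ℕ} (hμ : Finsupp.degree μ < Y.card) :
    gradedPiece (colourWeight r κ) (prodIdeal (fun i => colourSpace (κ := κ) (v i)) Y ⊔ I) μ =
      gradedPiece (colourWeight r κ) I μ := by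
  apply le_antisymm
  · rintro f ⟨hf, hfd⟩
    refine ⟨?_, hfd⟩
    obtain ⟨j, hj, y, hy, rfl⟩ := Submodule.mem_sup.1 hf
    have h0 : weightedHomogeneousComponent (colourWeight r κ) μ j = 0 := by
      have h1 := prodIdeal_le_pow_idealOfVars _ _ (isGradedIdeal_prodIdeal_colourSpace v Y μ j hj)
      rw [mem_pow_idealOfVars_iff'] at h1
      ext s
      rw [coeff_zero]
      by_cases hs : Finsupp.degree s < Y.card
      · exact h1 s hs
      · by_contra hne
        have h2 := weightedHomogeneousComponent_isWeightedHomogeneous (w := colourWeight r κ) μ j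
        have h3 := IsWeightedHomogeneous.map_weight Finsupp.degree h2 hne
        rw [degree_comp_colourWeight] at h3
        have h4 := DFunLike.congr_fun (Finsupp.degree_eq_weight_one (R := ℕ)) s
        have h5 : Finsupp.degree s = Finsupp.degree μ := h4.trans h3
        omega
    rw [← weightedHomogeneousComponent_eq_self hfd, map_add, h0, zero_add]
    exact hI _ _ hy
  · exact fun f hf => ⟨Ideal.mem_sup_right hf.1, hf.2⟩

end ColouredForms

section RankFunction

variable {k κ : Type*} [Field k] {r : ℕ}

theorem exists_dual_complement {V : Type*} [AddCommGroup V] [Module k V] [FiniteDimensional k V]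
    (W : Submodule k V) {m : ℕ} (hm : Module.finrank k W + m = Module.finrank k V) :
    ∃ (B : Fin m → V) (φ : Fin m → V →ₗ[k] k),
      (∀ s t, φ s (B t) = if s = t then 1 else 0) ∧ (∀ s, ∀ x ∈ W, φ s x = 0) ∧
      W ⊔ Submodule.span k (Set.range B) = ⊤ := by
  have hq : Module.finrank k (V ⧸ W) = m := by
    have := W.finrank_quotient_add_finrank
    omega
  let b := Module.finBasisOfFinrankEq k (V ⧸ W) hq
  choose B hB using fun t => W.mkQ_surjective (b t)
  refine ⟨B, fun s => b.coord s ∘ₗ W.mkQ, fun s t => ?_, fun s x hx => ?_, ?_⟩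
  · rw [LinearMap.comp_apply, hB, Module.Basis.coord_apply, Module.Basis.repr_self,
      Finsupp.single_apply]
    simp only [eq_comm]
  · rw [LinearMap.comp_apply, Submodule.mkQ_apply, (Submodule.Quotient.mk_eq_zero W).2 hx, map_zero]
  · rw [eq_top_iff]
    intro x _
    have h1 : x - ∑ t, b.coord t (W.mkQ x) • B t ∈ W := by
      rw [← Submodule.Quotient.mk_eq_zero, ← Submodule.mkQ_apply, map_sub, map_sum]
      simp only [map_smul, hB, Module.Basis.coord_apply]
      rw [b.sum_repr, sub_self]
    rw [← sub_add_cancel x (∑ t, b.coord t (W.mkQ x) • B t)]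
    exact Submodule.add_mem_sup h1
      (sum_mem fun t _ => Submodule.smul_mem _ _ (Submodule.subset_span ⟨t, rfl⟩))

/-- Placing a vector in the colour `c`, as a linear map. -/
def colourMap [DecidableEq κ] (c : κ) : (Fin r → k) →ₗ[k] (Fin r × κ → k) where
  toFun b := colourVec b c
  map_add' b b' := by ext p; simp only [colourVec, Pi.add_apply]; split_ifs <;> simp
  map_smul' a b := by ext p; simp [colourVec]

variable [Fintype κ] [DecidableEq κ]

theorem eq_sum_colourVec (f : Fin r × κ → k) : f = ∑ c, colourVec (fun a => f (a, c)) c := by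
  ext ⟨a, d⟩
  simp [Finset.sum_apply, colourVec]

theorem sup_colourSpace_sup_colouredSpan_eq_top {ι : Type*} [Fintype ι] {m : ℕ} {v : ι → Fin r → k}
    {B : Fin m → Fin r → k}
    (h : Submodule.span k (Set.range v) ⊔ Submodule.span k (Set.range B) = ⊤) :
    Finset.univ.sup (fun i => colourSpace (κ := κ) (v i)) ⊔ colouredSpan B Finset.univ = ⊤ := by
  rw [eq_top_iff]
  intro f _
  rw [eq_sum_colourVec f]
  refine sum_mem fun c _ => ?_
  have : Submodule.span k (Set.range v) ⊔ Submodule.span k (Set.range B) ≤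
      (Finset.univ.sup (fun i => colourSpace (κ := κ) (v i)) ⊔
        colouredSpan B Finset.univ).comap (colourMap c) := by
    refine sup_le (Submodule.span_le.2 ?_) (Submodule.span_le.2 ?_)
    · rintro _ ⟨i, rfl⟩
      refine Submodule.mem_sup_left (Finset.le_sup (f := fun i => colourSpace (κ := κ) (v i))
        (Finset.mem_univ i) ?_)
      exact Submodule.subset_span ⟨c, rfl⟩
    · rintro _ ⟨t, rfl⟩
      exact Submodule.mem_sup_right
        (Submodule.subset_span ⟨(t, c), Finset.mem_coe.2 (Finset.mem_univ _), rfl⟩)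
  rw [h] at this
  exact this (x := fun a => f (a, c)) trivial

theorem prodIdeal_subtype {ι τ : Type*} [Fintype τ] (Y : Finset ι) (U : ι → Submodule k (τ → k))
    (Z : Finset Y) : prodIdeal (fun i : Y => U i) Z =
      prodIdeal U (Z.map (Function.Embedding.subtype fun x => x ∈ Y)) := by
  simp [prodIdeal, Finset.prod_map]

theorem eq_univ_of_sum_neg_one_pow_eq_zero {ι : Type*} [Fintype ι] {f g : Finset ι → ℕ}
    (hf : ∑ Z : Finset ι, (-1 : ℤ) ^ Z.card * f Z = 0)
    (hg : ∑ Z : Finset ι, (-1 : ℤ) ^ Z.card * g Z = 0)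
    (h : ∀ Z, Z ≠ Finset.univ → f Z = g Z) : f Finset.univ = g Finset.univ := by
  classical
  rw [← Finset.add_sum_erase _ _ (Finset.mem_univ Finset.univ)] at hf hg
  rw [Finset.sum_congr rfl fun Z hZ => by rw [h Z (Finset.mem_erase.1 hZ).1], ← hg] at hf
  exact_mod_cast mul_left_cancel₀ (pow_ne_zero _ (by norm_num)) (add_right_cancel hf)

theorem sum_neg_one_pow_finrank_gradedPiece [CharZero k] {ι : Type*} [Fintype ι] [LinearOrder ι]
    [Nonempty ι] {m : ℕ} {v : ι → Fin r → k} {B : Fin m → Fin r → k}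
    (h : Submodule.span k (Set.range v) ⊔ Submodule.span k (Set.range B) = ⊤) {μ : κ →₀ ℕ}
    (hμ : Fintype.card ι ≤ Finsupp.degree μ) :
    ∑ Z : Finset ι, (-1 : ℤ) ^ Z.card * Module.finrank k (gradedPiece (colourWeight r κ)
      (prodIdeal (fun i => colourSpace (κ := κ) (v i)) Z ⊔
        formIdeal (colouredSpan B Finset.univ)) μ) = 0 := by
  have := fun J : Ideal (MvPolynomial (Fin r × κ) k) =>
    finiteDimensional_gradedPiece degree_comp_colourWeight J μ
  refine sum_neg_one_pow_finrank_eq_zero _ (fun Y Z hYZ f hf => ?_) fun a ha hda => ?_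
  · exact ⟨sup_le_sup_right (prodIdeal_anti _ hYZ) _ hf.1, hf.2⟩
  · exact exists_cubeDiff_eq Finsupp.degree degree_comp_colourWeight
      (isGradedIdeal_prodIdeal_colourSpace v) (isGradedIdeal_colouredSpan B _)
      (sup_colourSpace_sup_colouredSpan_eq_top h) hμ a ha hda

/-- The multigraded Hilbert function of a product of ideals generated by coloured copies of vectors
is a function of the rank function of the vectors. -/
theorem sameHilbert_prodIdeal [CharZero k] {ι : Type*} [LinearOrder ι] (v w : ι → Fin r → k)
    (hvw : ∀ Y : Finset ι, Module.finrank k (Submodule.span k (Set.range fun i : Y => v i)) =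
      Module.finrank k (Submodule.span k (Set.range fun i : Y => w i))) (Y : Finset ι) :
    SameHilbert (colourWeight r κ) (prodIdeal (fun i => colourSpace (κ := κ) (v i)) Y)
      (prodIdeal (fun i => colourSpace (κ := κ) (w i)) Y) := by
  induction Y using Finset.strongInduction with
  | H Y ih =>
    rcases Y.eq_empty_or_nonempty with rfl | hne
    · have h : prodIdeal (fun i => colourSpace (κ := κ) (v i)) ∅ =
          prodIdeal (fun i => colourSpace (κ := κ) (w i)) ∅ := by
        rw [prodIdeal, prodIdeal, Finset.prod_empty, Finset.prod_empty]
      rw [h]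
      exact fun μ => rfl
    have hle : Module.finrank k (Submodule.span k (Set.range fun i : Y => v i)) ≤
      Module.finrank k (Fin r → k) := Submodule.finrank_le _
    obtain ⟨m, hm⟩ := Nat.exists_eq_add_of_le hle
    obtain ⟨B, φ, hφ, hφv, hB⟩ := exists_dual_complement _ hm.symm
    obtain ⟨B', φ', hφ', hφw, hB'⟩ := exists_dual_complement _ ((hvw Y) ▸ hm.symm)
    have hd : ∀ (v : ι → Fin r → k) (φ : Fin m → (Fin r → k) →ₗ[k] k),
        (∀ s, ∀ x ∈ Submodule.span k (Set.range fun i : Y => v i), φ s x = 0) →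
        ∀ Z ⊆ Y, ∀ s c, IsDerivClosed (colourFunctional (φ s) c)
          (prodIdeal (fun i => colourSpace (κ := κ) (v i)) Z) := by
      intro v φ h Z hZ s c
      exact IsDerivClosed.prod _ fun i hi => isDerivClosed_colourSpace
        (h s _ (Submodule.subset_span ⟨⟨i, hZ hi⟩, rfl⟩)) c
    have key : ∀ Z ⊆ Y, (SameHilbert (colourWeight r κ)
        (prodIdeal (fun i => colourSpace (κ := κ) (v i)) Z)
        (prodIdeal (fun i => colourSpace (κ := κ) (w i)) Z) ↔
      SameHilbert (colourWeight r κ)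
        (prodIdeal (fun i => colourSpace (κ := κ) (v i)) Z ⊔
          formIdeal (colouredSpan B Finset.univ))
        (prodIdeal (fun i => colourSpace (κ := κ) (w i)) Z ⊔
          formIdeal (colouredSpan B' Finset.univ))) := fun Z hZ =>
      sameHilbert_sup_colouredSpan_iff (isGradedIdeal_prodIdeal_colourSpace v Z)
        (isGradedIdeal_prodIdeal_colourSpace w Z) hφ hφ' (hd v φ hφv Z hZ) (hd w φ' hφw Z hZ) _
    rw [key Y subset_rfl]
    intro μ
    by_cases hμ : Finsupp.degree μ < Y.card
    · rw [gradedPiece_prodIdeal_sup_of_lt v Y (isGradedIdeal_colouredSpan B _) hμ,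
        gradedPiece_prodIdeal_sup_of_lt w Y (isGradedIdeal_colouredSpan B' _) hμ]
      have hbot : ∀ ψ : (Fin r × κ → k) →ₗ[k] k,
          IsDerivClosed ψ (⊥ : Ideal (MvPolynomial (Fin r × κ) k)) := by
        intro ψ f hf
        rw [Ideal.mem_bot] at hf ⊢
        rw [hf, map_zero]
      have h0 := (sameHilbert_sup_colouredSpan_iff (J := ⊥) (J' := ⊥) (isGradedIdeal_bot)
        (isGradedIdeal_bot) hφ hφ' (fun _ _ => hbot _) (fun _ _ => hbot _)
        (Finset.univ : Finset (Fin m × κ))).1 (fun _ => rfl) μ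
      rwa [bot_sup_eq, bot_sup_eq] at h0
    · have : Nonempty Y := hne.to_subtype
      have hμ' : Fintype.card Y ≤ Finsupp.degree μ := by
        rw [Fintype.card_coe]; omega
      have e1 := sum_neg_one_pow_finrank_gradedPiece hB hμ'
      have e2 := sum_neg_one_pow_finrank_gradedPiece hB' hμ'
      have e3 := eq_univ_of_sum_neg_one_pow_eq_zero e1 e2 fun Z hZ => by
        have hZY : Z.map (Function.Embedding.subtype _) ⊂ Y := by
          rw [Finset.ssubset_iff_subset_ne]
          refine ⟨Finset.map_subtype_subset _, fun h => hZ ?_⟩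
          rw [Finset.eq_univ_iff_forall]
          intro i
          obtain ⟨j, hj, hji⟩ := Finset.mem_map.1 ((Finset.ext_iff.1 h i).2 i.2)
          exact Subtype.ext hji ▸ hj
        rw [prodIdeal_subtype Y (fun i => colourSpace (κ := κ) (v i)) Z,
          prodIdeal_subtype Y (fun i => colourSpace (κ := κ) (w i)) Z]
        exact (key _ hZY.1).1 (ih _ hZY) μ
      rwa [prodIdeal_subtype Y (fun i => colourSpace (κ := κ) (v i)) Finset.univ,
        prodIdeal_subtype Y (fun i => colourSpace (κ := κ) (w i)) Finset.univ,
        Finset.univ_eq_attach, Finset.attach_map_val] at e3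

theorem finrank_span_le_of_linearIndependent {V V' ι : Type*} [AddCommGroup V] [Module k V]
    [AddCommGroup V'] [Module k V'] {v : ι → V} {w : ι → V'}
    (h : ∀ S : Finset ι, LinearIndependent k (fun j : S => v j) →
      LinearIndependent k (fun j : S => w j)) (Y : Finset ι) :
    Module.finrank k (Submodule.span k (Set.range fun i : Y => v i)) ≤
      Module.finrank k (Submodule.span k (Set.range fun i : Y => w i)) := by
  classical
  have : FiniteDimensional k (Submodule.span k (Set.range fun i : Y => v i)) :=
    FiniteDimensional.span_of_finite k (Set.finite_range _)
  obtain ⟨f, hf, -, hli⟩ := Submodule.exists_fun_fin_finrank_span_eq k (Set.range fun i : Y => v i)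
  choose g hg using hf
  have hgi : Function.Injective fun t => (g t : ι) := by
    intro s t hst
    apply hli.injective
    rw [← hg s, ← hg t]
    exact congrArg v hst
  set S : Finset ι := Finset.univ.map ⟨_, hgi⟩ with hS
  have hcard : S.card = Module.finrank k (Submodule.span k (Set.range fun i : Y => v i)) := by
    rw [hS, Finset.card_map, Finset.card_fin]
  have hSv : LinearIndependent k (fun j : S => v j) := by
    choose t ht using fun j : S => Finset.mem_map.1 j.2
    have : (fun j : S => v j) = f ∘ t := by
      funext j
      rw [Function.comp_apply, ← hg (t j), ← (ht j).2]
      rfl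
    rw [this]
    refine hli.comp _ fun i j hij => Subtype.ext ?_
    rw [← (ht i).2, ← (ht j).2, hij]
  have hSw := h S hSv
  have hSY : Set.range (fun j : S => w j) ⊆ Set.range fun i : Y => w i := by
    rintro _ ⟨j, rfl⟩
    obtain ⟨t, -, ht⟩ := Finset.mem_map.1 j.2
    exact ⟨g t, congrArg w ht⟩
  have : FiniteDimensional k (Submodule.span k (Set.range fun i : Y => w i)) :=
    FiniteDimensional.span_of_finite k (Set.finite_range _)
  rw [← hcard, ← Fintype.card_coe, ← finrank_span_eq_card hSw]
  exact Submodule.finrank_mono (Submodule.span_mono hSY)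

end RankFunction

section Polarization

theorem exists_perm_of_sum_single_eq {α β : Type*} [Fintype α] {f g : α → β}
    (h : ∑ i, Finsupp.single (f i) 1 = ∑ i, Finsupp.single (g i) (1 : ℕ)) :
    ∃ π : Equiv.Perm α, g ∘ π = f := by
  classical
  have hcard : ∀ b, Fintype.card {a // f a = b} = Fintype.card {a // g a = b} := by
    intro b
    have := DFunLike.congr_fun h b
    simpa [Finsupp.finsetSum_apply, Finsupp.single_apply, Fintype.card_subtype] using this
  let e : Equiv.Perm α := Equiv.ofFiberEquiv fun b => Fintype.equivOfCardEq (hcard b)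
  exact ⟨e, funext fun a => Equiv.ofFiberEquiv_map _ a⟩

theorem finrank_range_eq_of_ker_eq {k V W W' : Type*} [Field k] [AddCommGroup V] [Module k V]
    [AddCommGroup W] [Module k W] [AddCommGroup W'] [Module k W'] {f : V →ₗ[k] W} {g : V →ₗ[k] W'}
    (h : LinearMap.ker f = LinearMap.ker g) :
    Module.finrank k (LinearMap.range f) = Module.finrank k (LinearMap.range g) :=
  (f.quotKerEquivRange.symm ≪≫ₗ Submodule.quotEquivOfEq _ _ h ≪≫ₗ g.quotKerEquivRange).finrank_eq

variable {k κ : Type*} [Field k] {r n : ℕ} [Fintype κ] [DecidableEq κ]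

theorem linForm_colourVec (b : Fin r → k) (c : κ) :
    linForm (colourVec b c) = ∑ i, C (b i) * X (i, c) := by
  rw [linForm_apply, Fintype.sum_prod_type]
  refine Finset.sum_congr rfl fun i _ => ?_
  rw [Finset.sum_eq_single c]
  · simp [colourVec]
  · intro d _ hd
    simp [colourVec, hd]
  · exact fun h => absurd (Finset.mem_univ c) h

/-- The linear form on coloured variables attached to a vector placed in the colour `c`. -/
def colourForm (r : ℕ) (k : Type*) [Field k] (c : κ) :
    (Fin r → k) →ₗ[k] MvPolynomial (Fin r × κ) k :=
  Fintype.linearCombination k fun i => X (i, c)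

theorem colourForm_apply (b : Fin r → k) (c : κ) :
    colourForm r k c b = linForm (colourVec b c) := by
  rw [linForm_colourVec]
  simp [colourForm, Fintype.linearCombination_apply, smul_eq_C_mul]

/-- The map sending `t₁ ⊗ ⋯ ⊗ t_n` to the product of the linear forms `t_j` in the colours `c j`. -/
def polarize (c : Fin n → κ) :
    (PiTensorProduct k fun _ : Fin n => Fin r → k) →ₗ[k] MvPolynomial (Fin r × κ) k :=
  PiTensorProduct.lift
    ((MultilinearMap.mkPiAlgebra k (Fin n) (MvPolynomial (Fin r × κ) k)).compLinearMap
      fun j => colourForm r k (c j))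

theorem polarize_tprod (c : Fin n → κ) (t : Fin n → Fin r → k) :
    polarize c (PiTensorProduct.tprod k t) = ∏ j, linForm (colourVec (t j) (c j)) := by
  rw [polarize, PiTensorProduct.lift.tprod, MultilinearMap.compLinearMap_apply,
    MultilinearMap.mkPiAlgebra_apply]
  simp_rw [colourForm_apply]

theorem permAct_tprod (π : Equiv.Perm (Fin n)) (t : Fin n → Fin r → k) :
    permAct k π (PiTensorProduct.tprod k t) = PiTensorProduct.tprod k (t ∘ π.symm) :=
  PiTensorProduct.reindex_tprod π t

theorem polarize_permAct (c : Fin n → κ) (π : Equiv.Perm (Fin n))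
    (x : PiTensorProduct k fun _ : Fin n => Fin r → k) :
    polarize c (permAct k π x) = polarize (c ∘ π) x := by
  rw [← LinearMap.comp_apply]
  congr 1
  refine PiTensorProduct.ext (MultilinearMap.ext fun t => ?_)
  simp only [LinearMap.compMultilinearMap_apply, LinearMap.comp_apply]
  rw [permAct_tprod, polarize_tprod, polarize_tprod, ← Equiv.prod_comp π]
  simp

omit [Fintype κ] in
theorem weightedHomogeneousComponent_mul_eq_zero {μ ν : κ →₀ ℕ} {a P : MvPolynomial (Fin r × κ) k}
    (hP : IsWeightedHomogeneous (colourWeight r κ) P ν)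
    (hdeg : Finsupp.degree ν = Finsupp.degree μ) (hne : ν ≠ μ) :
    weightedHomogeneousComponent (colourWeight r κ) μ (a * P) = 0 := by
  classical
  by_contra h
  obtain ⟨s, hs⟩ := ne_zero_iff.1 h
  rw [coeff_weightedHomogeneousComponent] at hs
  obtain ⟨hsμ, hs⟩ := ite_ne_right_iff.1 hs
  rw [coeff_mul] at hs
  obtain ⟨p, hp, hps⟩ := Finset.exists_ne_zero_of_sum_ne_zero hs
  have h2 := hP (right_ne_zero_of_mul hps)
  rw [← Finset.HasAntidiagonal.mem_antidiagonal.1 hp, map_add, h2] at hsμ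
  have h1 : Finsupp.weight (colourWeight r κ) p.1 = 0 := by
    rw [← Finsupp.degree_eq_zero_iff]
    have := congrArg Finsupp.degree hsμ
    rw [map_add] at this
    omega
  rw [h1, zero_add] at hsμ
  exact hne hsμ

/-- The elements of `𝔖(v)`, polarized along a colouring, form a graded piece of the product of the
ideals of coloured copies of the columns of `v`. -/
theorem map_polarize_symMod (v : Matrix (Fin r) (Fin n) k) (c : Fin n → κ) :
    (symMod k v).map (polarize c) = gradedPiece (colourWeight r κ)
      (prodIdeal (fun j => colourSpace (κ := κ) fun i => v i j) Finset.univ)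
      (∑ j, Finsupp.single (c j) 1) := by
  classical
  have hP : ∀ f : Fin n → κ, IsWeightedHomogeneous (colourWeight r κ)
      (∏ j, linForm (colourVec (fun i => v i j) (f j))) (∑ j, Finsupp.single (f j) 1) := fun f =>
    IsWeightedHomogeneous.prod _ _ _ fun j _ => isWeightedHomogeneous_linForm_colourVec _ _
  have hgen : ∀ π : Equiv.Perm (Fin n), polarize c (permAct k π (vtens k v)) =
      ∏ j, linForm (colourVec (fun i => v i j) (c (π j))) := fun π => by
    rw [polarize_permAct, vtens, polarize_tprod]
    rfl
  apply le_antisymm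
  · rw [symMod, Submodule.map_span, Submodule.span_le]
    rintro _ ⟨_, ⟨π, rfl⟩, rfl⟩
    rw [hgen]
    refine mem_gradedPiece.2 ⟨Ideal.prod_mem_prod fun j _ => linForm_mem_formIdeal
      (Submodule.subset_span ⟨_, rfl⟩), ?_⟩
    have := hP (c ∘ π)
    rwa [show ∑ j, Finsupp.single ((c ∘ π) j) 1 = ∑ j, Finsupp.single (c j) (1 : ℕ) from
      Equiv.sum_comp π fun j => Finsupp.single (c j) 1] at this
  · intro x hx
    obtain ⟨hxI, hxw⟩ := mem_gradedPiece.1 hx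
    have hI : prodIdeal (fun j => colourSpace (κ := κ) fun i => v i j) Finset.univ =
        Ideal.span (Set.range fun f : Fin n → κ =>
          ∏ j, linForm (colourVec (fun i => v i j) (f j))) := by
      have : ∀ j, formIdeal (colourSpace (κ := κ) fun i => v i j) =
          Ideal.span (Set.range fun c : κ => linForm (colourVec (fun i => v i j) c)) := fun j => by
        rw [colourSpace, formIdeal_span, ← Set.range_comp]
        rfl
      rw [prodIdeal, Finset.prod_congr rfl fun j _ => this j, Ideal.prod_span]
      congr 1
      ext y
      rw [Set.mem_fintype_prod]
      constructor
      · rintro ⟨g, hg, rfl⟩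
        choose f hf using hg
        exact ⟨f, Finset.prod_congr rfl fun j _ => hf j⟩
      · rintro ⟨f, rfl⟩
        exact ⟨_, fun j => ⟨f j, rfl⟩, rfl⟩
    rw [hI, Ideal.mem_span_range_iff_exists_fun] at hxI
    obtain ⟨a, rfl⟩ := hxI
    rw [← weightedHomogeneousComponent_eq_self hxw, map_sum]
    refine Submodule.sum_mem _ fun f _ => ?_
    by_cases hf : ∑ j, Finsupp.single (f j) 1 = ∑ j, Finsupp.single (c j) (1 : ℕ)
    · obtain ⟨π, rfl⟩ := exists_perm_of_sum_single_eq hf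
      rw [mul_comm, ← add_zero (∑ j, Finsupp.single (c j) (1 : ℕ)), ← hf,
        weightedHomogeneousComponent_mul_add (hP _), weightedHomogeneousComponent_zero, mul_comm,
        ← smul_eq_C_mul]
      · refine Submodule.smul_mem _ _ ⟨_, Submodule.subset_span ⟨π, rfl⟩, hgen π⟩
      · intro p
        simp [colourWeight]
    · rw [weightedHomogeneousComponent_mul_eq_zero (hP f) (by simp) hf]
      exact Submodule.zero_mem _

/-- The sum of the permutations preserving the colouring `c`. -/
def youngSum (k : Type*) [Field k] (r : ℕ) (c : Fin n → κ) :
    (PiTensorProduct k fun _ : Fin n => Fin r → k) →ₗ[k]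
      PiTensorProduct k fun _ : Fin n => Fin r → k :=
  ∑ π ∈ Finset.univ.filter (fun π : Equiv.Perm (Fin n) => c ∘ π = c), permAct k π

theorem polarize_single (c : Fin n → κ) (s : Fin n → Fin r) :
    polarize c (PiTensorProduct.tprod k fun j => Pi.single (s j) 1) =
      monomial (∑ j, Finsupp.single (s j, c j) 1) 1 := by
  rw [polarize_tprod, monomial_sum_one]
  refine Finset.prod_congr rfl fun j _ => ?_
  rw [linForm_colourVec, Finset.sum_eq_single (s j)]
  · simp [X]
  · intro i _ hi
    simp [hi]
  · exact fun h => absurd (Finset.mem_univ _) h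

theorem permAct_mul (π ρ : Equiv.Perm (Fin n)) :
    permAct k (r := r) (π * ρ) = permAct k π ∘ₗ permAct k ρ := by
  refine PiTensorProduct.ext (MultilinearMap.ext fun t => ?_)
  simp only [LinearMap.compMultilinearMap_apply, LinearMap.comp_apply]
  rw [permAct_tprod, permAct_tprod, permAct_tprod]
  rfl

theorem permAct_one : permAct k (r := r) (1 : Equiv.Perm (Fin n)) = LinearMap.id := by
  refine PiTensorProduct.ext (MultilinearMap.ext fun t => ?_)
  simp only [LinearMap.compMultilinearMap_apply]
  rw [permAct_tprod]
  rfl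

omit [Fintype κ] in
theorem youngSum_permAct (c : Fin n → κ) {ρ : Equiv.Perm (Fin n)} (hρ : c ∘ ρ = c)
    (x : PiTensorProduct k fun _ : Fin n => Fin r → k) :
    youngSum k r c (permAct k ρ x) = youngSum k r c x := by
  rw [youngSum, LinearMap.sum_apply, LinearMap.sum_apply]
  refine Finset.sum_equiv (Equiv.mulRight ρ) (fun π => ?_) fun π _ => ?_
  · have : c ∘ π = c ↔ (c ∘ π) ∘ ρ = c :=
      ⟨fun h => by rw [h, hρ], fun h => ρ.surjective.injective_comp_right (h.trans hρ.symm)⟩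
    simpa [Function.comp_assoc] using this
  · rw [Equiv.coe_mulRight, permAct_mul, LinearMap.comp_apply]

omit [Fintype κ] in
theorem permAct_youngSum (c : Fin n → κ) {ρ : Equiv.Perm (Fin n)} (hρ : c ∘ ρ = c)
    (x : PiTensorProduct k fun _ : Fin n => Fin r → k) :
    permAct k ρ (youngSum k r c x) = youngSum k r c x := by
  rw [youngSum, LinearMap.sum_apply, map_sum]
  refine Finset.sum_equiv (Equiv.mulLeft ρ) (fun π => ?_) fun π _ => ?_
  · have : c ∘ π = c ↔ (c ∘ ρ) ∘ π = c := by rw [hρ]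
    simpa [Function.comp_assoc] using this
  · rw [Equiv.coe_mulLeft, permAct_mul, LinearMap.comp_apply]

theorem polarize_youngSum (c : Fin n → κ) (x : PiTensorProduct k fun _ : Fin n => Fin r → k) :
    polarize c (youngSum k r c x) =
      (Finset.univ.filter fun π : Equiv.Perm (Fin n) => c ∘ π = c).card • polarize c x := by
  rw [youngSum, LinearMap.sum_apply, map_sum, Finset.sum_congr rfl fun π hπ => by
    rw [polarize_permAct, (Finset.mem_filter.1 hπ).2], Finset.sum_const]

theorem exists_comp_polarize_eq_youngSum (c : Fin n → κ) :
    ∃ Θ : MvPolynomial (Fin r × κ) k →ₗ[k] PiTensorProduct k fun _ : Fin n => Fin r → k,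
      Θ ∘ₗ polarize c = youngSum k r c := by
  classical
  let e : (Fin n → Fin r) → PiTensorProduct k fun _ : Fin n => Fin r → k := fun s =>
    PiTensorProduct.tprod k fun j => Pi.single (s j) 1
  let m : (Fin n → Fin r) → (Fin r × κ →₀ ℕ) := fun s => ∑ j, Finsupp.single (s j, c j) 1
  have hm : ∀ s t, m s = m t → youngSum k r c (e s) = youngSum k r c (e t) := by
    intro s t hst
    obtain ⟨π, hπ⟩ := exists_perm_of_sum_single_eq hst
    have h1 : t ∘ π = s := funext fun j => congrArg Prod.fst (congrFun hπ j)
    have h2 : c ∘ π = c := funext fun j => congrArg Prod.snd (congrFun hπ j)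
    rw [← youngSum_permAct c h2 (e s)]
    congr 1
    simp only [e]
    rw [permAct_tprod]
    congr 1
    funext j
    simp [← h1]
  let F : (Fin r × κ →₀ ℕ) → PiTensorProduct k fun _ : Fin n => Fin r → k := fun d =>
    if h : ∃ s, m s = d then youngSum k r c (e h.choose) else 0
  refine ⟨(basisMonomials (Fin r × κ) k).constr k F, ?_⟩
  refine PiTensorProduct.ext (Module.Basis.ext_multilinear (fun _ => Pi.basisFun k (Fin r)) ?_)
  intro s
  simp only [LinearMap.compMultilinearMap_apply, LinearMap.comp_apply, Pi.basisFun_apply]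
  rw [polarize_single, ← congrFun (coe_basisMonomials (Fin r × κ) k), Module.Basis.constr_basis]
  have h : ∃ t, m t = m s := ⟨s, rfl⟩
  exact (dif_pos h).trans (hm _ _ h.choose_spec)

theorem polarize_eq_zero_iff [CharZero k] (c : Fin n → κ)
    (x : PiTensorProduct k fun _ : Fin n => Fin r → k) :
    polarize c x = 0 ↔ youngSum k r c x = 0 := by
  constructor
  · intro h
    obtain ⟨Θ, hΘ⟩ := exists_comp_polarize_eq_youngSum (k := k) (r := r) c
    rw [← hΘ, LinearMap.comp_apply, h, map_zero]
  · intro h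
    have := polarize_youngSum c x
    rw [h, map_zero, eq_comm, ← Nat.cast_smul_eq_nsmul k, smul_eq_zero, Nat.cast_eq_zero,
      Finset.card_eq_zero] at this
    exact this.resolve_left (Finset.Nonempty.ne_empty ⟨1, by simp⟩)

end Polarization

section SymmetricGroupModule

theorem trace_eq_mul_finrank_range {k V U : Type*} [Field k] [AddCommGroup V] [Module k V]
    [FiniteDimensional k V] [AddCommGroup U] [Module k U] {f : V →ₗ[k] V} {m : k} (hm : m ≠ 0)
    (hf : f ∘ₗ f = m • f) {g : V →ₗ[k] U} (hfg : LinearMap.ker f = LinearMap.ker g) :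
    LinearMap.trace k V f = m * Module.finrank k (LinearMap.range g) := by
  have hidem : IsIdempotentElem (m⁻¹ • f) := by
    change (m⁻¹ • f) ∘ₗ (m⁻¹ • f) = m⁻¹ • f
    rw [LinearMap.smul_comp, LinearMap.comp_smul, hf, inv_smul_smul₀ hm]
  have h := ((LinearMap.isProj_range_iff_isIdempotentElem _).2 hidem).trace
  rw [LinearMap.range_smul _ _ (inv_ne_zero hm), map_smul, smul_eq_mul,
    finrank_range_eq_of_ker_eq hfg] at h
  rw [← h, mul_inv_cancel_left₀ hm]

variable {k : Type*} [Field k] {r n : ℕ}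

theorem permAct_mem_symMod (v : Matrix (Fin r) (Fin n) k) (π : Equiv.Perm (Fin n))
    {x : PiTensorProduct k fun _ : Fin n => Fin r → k} (hx : x ∈ symMod k v) :
    permAct k π x ∈ symMod k v := by
  have : symMod k v ≤ (symMod k v).comap (permAct k π) := by
    conv_lhs => rw [symMod]
    rw [Submodule.span_le]
    rintro _ ⟨ρ, rfl⟩
    refine Submodule.subset_span ⟨π * ρ, ?_⟩
    rw [permAct_mul, LinearMap.comp_apply]
  exact this hx

instance (v : Matrix (Fin r) (Fin n) k) : FiniteDimensional k (symMod k v) :=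
  FiniteDimensional.span_of_finite k <|
    (Set.finite_range fun σ => permAct k σ (vtens k v)).subset <| by
      rintro _ ⟨σ, rfl⟩
      exact ⟨σ, rfl⟩

/-- The representation of the symmetric group on `𝔖(v)`. -/
def symRep (v : Matrix (Fin r) (Fin n) k) :
    Representation k (Equiv.Perm (Fin n)) (symMod k v) where
  toFun π := (permAct k π).restrict fun _ => permAct_mem_symMod v π
  map_one' := LinearMap.ext fun x => Subtype.ext <| by
    rw [LinearMap.coe_restrict_apply, permAct_one]
    rfl
  map_mul' π ρ := LinearMap.ext fun x => Subtype.ext <| by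
    rw [LinearMap.coe_restrict_apply, permAct_mul]
    rfl

theorem coe_symRep (v : Matrix (Fin r) (Fin n) k) (π : Equiv.Perm (Fin n)) (x : symMod k v) :
    (symRep v π x : PiTensorProduct k fun _ : Fin n => Fin r → k) = permAct k π x :=
  rfl

theorem sum_character_symRep [CharZero k] {κ : Type*} [Fintype κ] [DecidableEq κ]
    (v : Matrix (Fin r) (Fin n) k) (c : Fin n → κ) :
    ∑ π ∈ Finset.univ.filter (fun π : Equiv.Perm (Fin n) => c ∘ π = c),
        Representation.character (V := symMod k v) (symRep v) π =
      (Finset.univ.filter fun π : Equiv.Perm (Fin n) => c ∘ π = c).card *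
        (Module.finrank k (gradedPiece (colourWeight r κ)
          (prodIdeal (fun j => colourSpace (κ := κ) fun i => v i j) Finset.univ)
          (∑ j, Finsupp.single (c j) 1)) : k) := by
  set F := Finset.univ.filter fun π : Equiv.Perm (Fin n) => c ∘ π = c with hF
  let A : symMod k v →ₗ[k] symMod k v := ∑ π ∈ F, symRep v π
  have hA : ∀ x, (A x : PiTensorProduct k fun _ : Fin n => Fin r → k) = youngSum k r c x := by
    intro x
    simp only [A, youngSum, LinearMap.sum_apply, Submodule.coe_sum, coe_symRep, hF]
  have hAA : A ∘ₗ A = (F.card : k) • A := by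
    refine LinearMap.ext fun x => Subtype.ext ?_
    rw [LinearMap.comp_apply, LinearMap.smul_apply, Submodule.coe_smul, hA, hA]
    rw [show youngSum k r c (youngSum k r c x) = ∑ π ∈ F, permAct k π (youngSum k r c x) from
      LinearMap.sum_apply _ _ _,
      Finset.sum_congr rfl fun π hπ => permAct_youngSum c (Finset.mem_filter.1 hπ).2 _,
      Finset.sum_const, Nat.cast_smul_eq_nsmul]
  have hcard : (F.card : k) ≠ 0 :=
    Nat.cast_ne_zero.2 (Finset.card_ne_zero_of_mem (Finset.mem_filter.2 ⟨Finset.mem_univ 1, rfl⟩))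
  have hker : LinearMap.ker A = LinearMap.ker (polarize c ∘ₗ (symMod k v).subtype) := by
    ext x
    rw [LinearMap.mem_ker, LinearMap.mem_ker, LinearMap.comp_apply, Submodule.subtype_apply,
      polarize_eq_zero_iff, ← hA, Submodule.coe_eq_zero]
  have htr := trace_eq_mul_finrank_range (V := symMod k v) hcard hAA hker
  rw [LinearMap.range_comp, Submodule.range_subtype,
    map_polarize_symMod] at htr
  rw [← htr]
  exact (map_sum (LinearMap.trace k _) _ _).symm

theorem exists_linearEquiv_symRep [CharZero k] {v w : Matrix (Fin r) (Fin n) k}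
    (h : ∀ S : Finset (Fin n), LinearIndependent k (fun j : S => fun i => v i (j : Fin n)) ↔
      LinearIndependent k (fun j : S => fun i => w i (j : Fin n))) :
    ∃ Ψ : symMod k v ≃ₗ[k] symMod k w, ∀ π x, Ψ (symRep v π x) = symRep w π (Ψ x) := by
  have hrank : ∀ Y : Finset (Fin n),
      Module.finrank k (Submodule.span k (Set.range fun j : Y => fun i => v i j)) =
        Module.finrank k (Submodule.span k (Set.range fun j : Y => fun i => w i j)) := fun Y =>
    le_antisymm
      (finrank_span_le_of_linearIndependent (v := fun j i => v i j) (w := fun j i => w i j)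
        (fun S => (h S).1) Y)
      (finrank_span_le_of_linearIndependent (v := fun j i => w i j) (w := fun j i => v i j)
        (fun S => (h S).2) Y)
  let χ (u : Matrix (Fin r) (Fin n) k) (π : Equiv.Perm (Fin n)) : k :=
    Representation.character (V := symMod k u) (symRep u) π
  refine exists_linearEquiv_of_character_eq (V := symMod k v) (W := symMod k w) fun π =>
    sub_eq_zero.1 (classFunction_eq_zero (fun π => χ v π - χ w π) (fun π ρ hπρ => ?_)
      (fun c => ?_) π)
  · obtain ⟨g, rfl⟩ := isConj_iff.1 hπρ
    simp only [χ, Representation.char_conj]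
  · rw [Finset.sum_sub_distrib, sum_character_symRep, sum_character_symRep,
      sameHilbert_prodIdeal (fun j i => v i j) (fun j i => w i j) hrank, sub_self]

theorem symMod_permute_columns (w : Matrix (Fin r) (Fin n) k) (σ : Equiv.Perm (Fin n)) :
    symMod k (fun i j => w i (σ j)) = symMod k w := by
  have hw : vtens k (fun i j => w i (σ j)) = permAct k σ⁻¹ (vtens k w) := by
    unfold vtens
    rw [permAct_tprod]
    rfl
  unfold symMod
  congr 1
  ext x
  constructor
  · rintro ⟨π, rfl⟩
    exact ⟨π * σ⁻¹, by rw [hw, permAct_mul, LinearMap.comp_apply]⟩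
  · rintro ⟨π, rfl⟩
    refine ⟨π * σ, ?_⟩
    rw [hw, ← LinearMap.comp_apply, ← permAct_mul, mul_inv_cancel_right]

end SymmetricGroupModule

end

/-- If `v` and `w` have isomorphic matroids (via a permutation `σ` of the columns),
then the cyclic `S_n`-modules `𝔖(v)` and `𝔖(w)` are isomorphic as `S_n`-modules. -/
theorem symmetric_group_module_matroid_invariant
    {k : Type*} [Field k] [CharZero k] {r n : ℕ}
    (v w : Matrix (Fin r) (Fin n) k) (σ : Equiv.Perm (Fin n))
    (hM : ∀ S : Finset (Fin n),
      LinearIndependent k (fun j : S => fun i => v i (j : Fin n)) ↔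
      LinearIndependent k (fun j : S => fun i => w i (σ (j : Fin n)))) :
    ∃ Ψ : ↥(symMod k v) ≃ₗ[k] ↥(symMod k w),
      ∀ π : Equiv.Perm (Fin n), ∀ x y : ↥(symMod k v),
        y.1 = permAct k π x.1 → (Ψ y).1 = permAct k π (Ψ x).1 := by
  obtain ⟨Ψ, hΨ⟩ := exists_linearEquiv_symRep (w := fun i j => w i (σ j)) hM
  refine ⟨Ψ ≪≫ₗ LinearEquiv.ofEq _ _ (symMod_permute_columns w σ), fun π x y hxy => ?_⟩
  obtain rfl : y = symRep v π x := Subtype.ext hxy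
  exact congrArg Subtype.val (hΨ π x)
end
end

section
/- Let v ∈ k^{2×n} (n ≥ 2) have uniform matroid of rank 2, i.e. every pair of columns of v is linearly independent. For a, b ∈ k^×, the diagonal action of diag(a,b) ∈ GL_2(k) on (k²)^{⊗n} preserves G(v), and the trace of the induced endomorphism of G(v) equals ∑_{i=0}^{n} a^i b^{n−i} + ∑_{ℓ=1}^{⌊n/2⌋} (n−2ℓ+1) · ∑_{i=ℓ}^{n−ℓ} a^i b^{n−i}. (This is the character s_{(n,0)}(a,b) + ∑_{ℓ=1}^{n/2} (n−2ℓ+1) s_{(n−ℓ,ℓ)}(a,b) of the tensor module of the uniform matroid U_{2,n}.) -/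
noncomputable section

/-- The diagonal action of a matrix `g` on `(k²)^{⊗n}`. -/
def diagAct (k : Type*) [Field k] {r n : ℕ} (g : Matrix (Fin r) (Fin r) k) :
    (PiTensorProduct k fun _ : Fin n => Fin r → k) →ₗ[k]
      (PiTensorProduct k fun _ : Fin n => Fin r → k) :=
  PiTensorProduct.map fun _ => g.mulVecLin

/-- The tensor module `G(v)`. -/
def tensMod (k : Type*) [Field k] {r n : ℕ} (v : Matrix (Fin r) (Fin n) k) :
    Submodule k (PiTensorProduct k fun _ : Fin n => Fin r → k) :=
  Submodule.span k {x | ∃ g : (Matrix (Fin r) (Fin r) k)ˣ, x = diagAct k g.1 (vtens k v)}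

theorem sum_Icc_mul_eq (m n : ℕ) (h : 2 * m ≤ n) :
    ∑ l ∈ Finset.Icc 1 m, (n - 2 * l + 1) = m * (n - m) := by
  induction m with
  | zero => simp
  | succ m ih =>
    rw [Finset.sum_Icc_succ_top (by omega), ih (by omega)]
    obtain ⟨c, rfl⟩ := Nat.exists_eq_add_of_le h
    have h1 : 2 * (m + 1) + c - m = m + 2 + c := by omega
    have h2 : 2 * (m + 1) + c - (m + 1) = m + 1 + c := by omega
    have h3 : 2 * (m + 1) + c - 2 * (m + 1) = c := by omega
    rw [h1, h2, h3]
    ring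

theorem sum_weights_eq {k : Type*} [CommRing k] {n : ℕ} (w : ℕ → k) :
    ∑ l ∈ Finset.Icc 1 (n / 2), ((n - 2 * l + 1 : ℕ) : k) *
        ∑ i ∈ Finset.Icc l (n - l), w i =
      ∑ i ∈ Finset.range (n + 1), ((i * (n - i) : ℕ) : k) * w i := by
  simp_rw [Finset.mul_sum]
  rw [Finset.sum_comm' (t' := Finset.range (n + 1))
    (s' := fun i => Finset.Icc 1 (min i (n - i)))]
  · refine Finset.sum_congr rfl fun i hi => ?_
    rw [Finset.mem_range] at hi
    rw [← Finset.sum_mul, ← Nat.cast_sum, sum_Icc_mul_eq _ _ (by omega)]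
    congr 2
    rcases le_total i (n - i) with h | h
    · rw [min_eq_left h]
    · rw [min_eq_right h, mul_comm, Nat.sub_sub_self (by omega)]
  · intro l i
    simp only [Finset.mem_Icc, Finset.mem_range]
    omega

theorem sum_finsuppAntidiag_weights {k : Type*} [CommRing k] (m : ℕ) (a b : k) :
    ∑ s ∈ Finset.finsuppAntidiag (Finset.univ : Finset (Fin 2 × Fin 2)) m,
        a ^ (s (0, 0) + s (0, 1)) * b ^ (s (1, 0) + s (1, 1)) =
      ∑ i ∈ Finset.range (m + 1), (((i + 1) * (m - i + 1) : ℕ) : k) * (a ^ i * b ^ (m - i)) := by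
  have key : ∑ s ∈ Finset.finsuppAntidiag (Finset.univ : Finset (Fin 2 × Fin 2)) m,
        a ^ (s (0, 0) + s (0, 1)) * b ^ (s (1, 0) + s (1, 1)) =
      ∑ q ∈ (Finset.HasAntidiagonal.antidiagonal m).sigma
          fun p => Finset.HasAntidiagonal.antidiagonal p.1 ×ˢ Finset.HasAntidiagonal.antidiagonal p.2,
        a ^ q.1.1 * b ^ q.1.2 := by
    refine Finset.sum_bij' (fun s _ => ⟨(s (0, 0) + s (0, 1), s (1, 0) + s (1, 1)),
        ((s (0, 0), s (0, 1)), (s (1, 0), s (1, 1)))⟩)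
      (fun q _ => Finsupp.equivFunOnFinite.symm fun x =>
        ![![q.2.1.1, q.2.1.2], ![q.2.2.1, q.2.2.2]] x.1 x.2) ?_ ?_ ?_ ?_ ?_
    · intro s hs
      simp [Finset.mem_finsuppAntidiag, Fintype.sum_prod_type] at hs ⊢
      omega
    · rintro ⟨⟨p, q⟩, ⟨⟨c, d⟩, ⟨e, f⟩⟩⟩ hq
      simp [Finset.mem_finsuppAntidiag, Fintype.sum_prod_type] at hq ⊢
      omega
    · intro s hs
      ext ⟨i, j⟩
      fin_cases i <;> fin_cases j <;> simp
    · rintro ⟨⟨p, q⟩, ⟨⟨c, d⟩, ⟨e, f⟩⟩⟩ hq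
      simp at hq
      obtain ⟨-, rfl, rfl⟩ := hq
      simp
    · intro s hs
      rfl
  rw [key, Finset.sum_sigma, Finset.Nat.sum_antidiagonal_eq_sum_range_succ_mk]
  refine Finset.sum_congr rfl fun i _ => ?_
  simp [Finset.card_product]

/-- If a family of eigenvectors of `σ` is a basis of the image of `ψ : V* → P`, where
`ψ` intertwines the transpose of `D` with `σ` and has kernel the annihilator of `W`, then the
trace of `D` on `W` is the sum of the eigenvalues. -/
theorem trace_restrict_eq_sum_of_dual {k V P ι : Type*} [Field k] [AddCommGroup V] [Module k V]
    [FiniteDimensional k V] [AddCommGroup P] [Module k P] [Fintype ι]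
    (W : Submodule k V) (D : V →ₗ[k] V) (hD : ∀ x ∈ W, D x ∈ W)
    (ψ : Module.Dual k V →ₗ[k] P) (hker : LinearMap.ker ψ = W.dualAnnihilator)
    (σ : P →ₗ[k] P) (hσ : ∀ φ, ψ (φ ∘ₗ D) = σ (ψ φ))
    (h : ι → P) (hli : LinearIndependent k h)
    (hspan : Submodule.span k (Set.range h) = LinearMap.range ψ)
    (μ : ι → k) (hμ : ∀ x, σ (h x) = μ x • h x) :
    LinearMap.trace k W (D.restrict hD) = ∑ x, μ x := by
  classical
  let e : LinearMap.range ψ ≃ₗ[k] Module.Dual k W :=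
    (ψ.quotKerEquivRange.symm.trans (Submodule.quotEquivOfEq _ _ hker)).trans
      (Subspace.quotAnnihilatorEquiv W)
  have he : ∀ φ, e ⟨ψ φ, φ, rfl⟩ = W.dualRestrict φ := by
    intro φ
    have : ψ.quotKerEquivRange.symm ⟨ψ φ, φ, rfl⟩ = Submodule.Quotient.mk φ := by
      rw [LinearEquiv.symm_apply_eq]; rfl
    simp only [e, LinearEquiv.trans_apply, this, Submodule.quotEquivOfEq_mk,
      Subspace.quotAnnihilatorEquiv_apply]
  let B : Module.Basis ι k (Module.Dual k W) :=
    ((Module.Basis.span hli).map (LinearEquiv.ofEq _ _ hspan)).map e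
  have hB : ∀ x, Module.Dual.transpose (R := k) (D.restrict hD) (B x) = μ x • B x := by
    intro x
    obtain ⟨φ, hφ⟩ : h x ∈ LinearMap.range ψ :=
      hspan ▸ Submodule.subset_span (Set.mem_range_self x)
    have hBx : B x = W.dualRestrict φ := by
      rw [← he]
      simp only [B, Module.Basis.map_apply]
      congr 1
      apply Subtype.ext
      simp [Module.Basis.span_apply, hφ]
    have h2 : Module.Dual.transpose (R := k) (D.restrict hD) (W.dualRestrict φ) =
        W.dualRestrict (φ ∘ₗ D) := by
      ext y; rfl
    rw [hBx, h2, ← map_smul, ← sub_eq_zero, ← map_sub, ← LinearMap.mem_ker,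
      Submodule.dualRestrict_ker_eq_dualAnnihilator, ← hker, LinearMap.mem_ker, map_sub, hσ,
      map_smul, hφ, hμ, sub_self]
  rw [← LinearMap.trace_transpose', LinearMap.trace_eq_matrix_trace k B, Matrix.trace]
  refine Finset.sum_congr rfl fun x _ => ?_
  rw [Matrix.diag_apply, LinearMap.toMatrix_apply, hB]
  simp

section CoordinatePolynomials

open MvPolynomial

variable {k : Type*} [Field k] {n : ℕ}

/-- The linear form `∑ₑ v_{e,j} X_{c,e}`, i.e. the `c`-th coordinate of the `j`-th column of `X v`
for a generic matrix `X`. -/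
def colForm (v : Matrix (Fin 2) (Fin n) k) (j : Fin n) (c : Fin 2) :
    MvPolynomial (Fin 2 × Fin 2) k :=
  ∑ e, C (v e j) * X (c, e)

/-- The coordinate of `X v^⊗` at `f`, for a generic matrix `X`. -/
def coordPoly (v : Matrix (Fin 2) (Fin n) k) (f : Fin n → Fin 2) : MvPolynomial (Fin 2 × Fin 2) k :=
  ∏ j, colForm v j (f j)

variable (k) in
/-- The determinant of the generic `2 × 2` matrix. -/
def detPoly : MvPolynomial (Fin 2 × Fin 2) k :=
  X (0, 0) * X (1, 1) - X (0, 1) * X (1, 0)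

variable (k n) in
/-- The standard basis of `(k²)^{⊗n}`. -/
def tensBasis : Module.Basis (Fin n → Fin 2) k (PiTensorProduct k fun _ : Fin n => Fin 2 → k) :=
  Basis.piTensorProduct fun _ => Pi.basisFun k (Fin 2)

theorem eval_colForm (v : Matrix (Fin 2) (Fin n) k) (g : Matrix (Fin 2) (Fin 2) k)
    (j : Fin n) (c : Fin 2) :
    eval (fun x => g x.1 x.2) (colForm v j c) = g.mulVec (fun i => v i j) c := by
  simp [colForm, Matrix.mulVec, dotProduct, mul_comm]

theorem eval_detPoly (g : Matrix (Fin 2) (Fin 2) k) :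
    eval (fun x => g x.1 x.2) (detPoly k) = g.det := by
  simp [detPoly, Matrix.det_fin_two]

variable (k) in
theorem detPoly_ne_zero : detPoly k ≠ 0 := by
  intro h
  have := eval_detPoly (1 : Matrix (Fin 2) (Fin 2) k)
  simp [h] at this

theorem tensBasis_repr_diagAct_vtens (v : Matrix (Fin 2) (Fin n) k) (g : Matrix (Fin 2) (Fin 2) k)
    (f : Fin n → Fin 2) :
    (tensBasis k n).repr (diagAct k g (vtens k v)) f =
      eval (fun x => g x.1 x.2) (coordPoly v f) := by
  simp [tensBasis, diagAct, vtens, coordPoly, eval_colForm, PiTensorProduct.map_tprod]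

theorem diagAct_diagonal_tensBasis (d : Fin 2 → k) (f : Fin n → Fin 2) :
    diagAct k (Matrix.diagonal d) (tensBasis k n f) = (∏ j, d (f j)) • tensBasis k n f := by
  rw [tensBasis, Basis.piTensorProduct_apply, diagAct, PiTensorProduct.map_tprod,
    ← MultilinearMap.map_smul_univ]
  congr 1
  ext j i
  rw [Matrix.mulVecLin_apply, Matrix.mulVec_diagonal]
  rcases eq_or_ne i (f j) with rfl | h <;> simp [*]

theorem diagAct_mul (g h : Matrix (Fin 2) (Fin 2) k)
    (x : PiTensorProduct k fun _ : Fin n => Fin 2 → k) :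
    diagAct k (g * h) x = diagAct k g (diagAct k h x) := by
  simp only [diagAct, Matrix.mulVecLin_mul, PiTensorProduct.map_comp, LinearMap.comp_apply]

theorem diagAct_mem_tensMod (v : Matrix (Fin 2) (Fin n) k) {g : Matrix (Fin 2) (Fin 2) k}
    (hg : IsUnit g) : ∀ x ∈ tensMod k v, diagAct k g x ∈ tensMod k v := by
  obtain ⟨u, rfl⟩ := hg
  intro x hx
  refine Submodule.span_induction ?_ ?_ ?_ ?_ hx
  · rintro _ ⟨h, rfl⟩
    exact Submodule.subset_span ⟨u * h, by rw [Units.val_mul, diagAct_mul]⟩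
  · simp
  · intro x y _ _ hx hy
    rw [map_add]
    exact add_mem hx hy
  · intro c x _ hx
    rw [map_smul]
    exact Submodule.smul_mem _ _ hx

/-- The map sending a functional `φ` on `(k²)^{⊗n}` to the polynomial `X ↦ φ(X v^⊗)`. -/
def dualToPoly (v : Matrix (Fin 2) (Fin n) k) :
    Module.Dual k (PiTensorProduct k fun _ : Fin n => Fin 2 → k) →ₗ[k]
      MvPolynomial (Fin 2 × Fin 2) k :=
  ∑ f, (LinearMap.toSpanSingleton k _ (coordPoly v f)) ∘ₗ Module.Dual.eval k _ (tensBasis k n f)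

theorem dualToPoly_apply (v : Matrix (Fin 2) (Fin n) k)
    (φ : Module.Dual k (PiTensorProduct k fun _ : Fin n => Fin 2 → k)) :
    dualToPoly v φ = ∑ f, φ (tensBasis k n f) • coordPoly v f := by
  simp [dualToPoly]

theorem eval_dualToPoly (v : Matrix (Fin 2) (Fin n) k) (g : Matrix (Fin 2) (Fin 2) k)
    (φ : Module.Dual k (PiTensorProduct k fun _ : Fin n => Fin 2 → k)) :
    eval (fun x => g x.1 x.2) (dualToPoly v φ) = φ (diagAct k g (vtens k v)) := by
  conv_rhs => rw [← (tensBasis k n).sum_repr (diagAct k g (vtens k v))]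
  simp only [dualToPoly_apply, map_sum, map_smul, tensBasis_repr_diagAct_vtens, smul_eval,
    smul_eq_mul, mul_comm]

theorem ker_dualToPoly [Infinite k] (v : Matrix (Fin 2) (Fin n) k) :
    LinearMap.ker (dualToPoly v) = (tensMod k v).dualAnnihilator := by
  ext φ
  rw [LinearMap.mem_ker, Submodule.mem_dualAnnihilator]
  constructor
  · intro h x hx
    refine (Submodule.span_le (p := LinearMap.ker φ)).2 ?_ hx
    rintro _ ⟨g, rfl⟩
    rw [SetLike.mem_coe, LinearMap.mem_ker, ← eval_dualToPoly, h, map_zero]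
  · intro h
    refine (mul_eq_zero.1 (?_ : detPoly k * dualToPoly v φ = 0)).resolve_left (detPoly_ne_zero k)
    refine MvPolynomial.funext fun x => ?_
    obtain ⟨g, rfl⟩ : ∃ g : Matrix (Fin 2) (Fin 2) k, x = fun y => g y.1 y.2 :=
      ⟨Matrix.of fun i j => x (i, j), rfl⟩
    rw [map_mul, eval_detPoly, eval_dualToPoly, map_zero]
    by_cases hg : g.det = 0
    · rw [hg, zero_mul]
    · obtain ⟨u, rfl⟩ := (Matrix.isUnit_iff_isUnit_det g).2 (isUnit_iff_ne_zero.2 hg)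
      rw [h _ (Submodule.subset_span ⟨u, rfl⟩), mul_zero]

theorem range_dualToPoly (v : Matrix (Fin 2) (Fin n) k) :
    LinearMap.range (dualToPoly v) = Submodule.span k (Set.range (coordPoly v)) := by
  refine le_antisymm ?_ (Submodule.span_le.2 ?_)
  · rintro _ ⟨φ, rfl⟩
    rw [dualToPoly_apply]
    exact sum_mem fun f _ => Submodule.smul_mem _ _ (Submodule.subset_span ⟨f, rfl⟩)
  · rintro _ ⟨f, rfl⟩
    refine ⟨(tensBasis k n).coord f, ?_⟩
    rw [dualToPoly_apply, Finset.sum_eq_single f]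
    · simp
    · intro g _ hg
      simp [hg]
    · simp

/-- Rescaling the rows of the generic matrix. -/
def rowScale (d : Fin 2 → k) :
    MvPolynomial (Fin 2 × Fin 2) k →ₐ[k] MvPolynomial (Fin 2 × Fin 2) k :=
  aeval fun x => C (d x.1) * X x

theorem rowScale_colForm (d : Fin 2 → k) (v : Matrix (Fin 2) (Fin n) k) (j : Fin n) (c : Fin 2) :
    rowScale d (colForm v j c) = d c • colForm v j c := by
  simp [rowScale, colForm, smul_eq_C_mul, algebraMap_eq]
  ring

theorem rowScale_coordPoly (d : Fin 2 → k) (v : Matrix (Fin 2) (Fin n) k) (f : Fin n → Fin 2) :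
    rowScale d (coordPoly v f) = (∏ j, d (f j)) • coordPoly v f := by
  rw [coordPoly, map_prod, ← Finset.prod_smul]
  simp only [rowScale_colForm]

theorem rowScale_detPoly (d : Fin 2 → k) :
    rowScale d (detPoly k) = (d 0 * d 1) • detPoly k := by
  simp [rowScale, detPoly, smul_eq_C_mul]
  ring

theorem rowScale_monomial (d : Fin 2 → k) (s : Fin 2 × Fin 2 →₀ ℕ) :
    rowScale d (monomial s 1) =
      (d 0 ^ (s (0, 0) + s (0, 1)) * d 1 ^ (s (1, 0) + s (1, 1))) • monomial s 1 := by
  rw [rowScale, aeval_monomial, monomial_eq, Finsupp.prod_fintype _ _ (by simp),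
    Finsupp.prod_fintype _ _ (by simp), smul_eq_C_mul]
  simp [Fintype.prod_prod_type]
  ring

theorem dualToPoly_comp_diagAct (d : Fin 2 → k) (v : Matrix (Fin 2) (Fin n) k)
    (φ : Module.Dual k (PiTensorProduct k fun _ : Fin n => Fin 2 → k)) :
    dualToPoly v (φ ∘ₗ diagAct k (Matrix.diagonal d)) =
      (rowScale d).toLinearMap (dualToPoly v φ) := by
  simp only [dualToPoly_apply, map_sum, LinearMap.comp_apply, diagAct_diagonal_tensBasis,
    map_smul, AlgHom.toLinearMap_apply, rowScale_coordPoly, smul_smul, smul_eq_mul]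
  refine Finset.sum_congr rfl fun f _ => ?_
  rw [mul_comm]

end CoordinatePolynomials

section SpanningFamily

open MvPolynomial

variable {k : Type*} [Field k] {n : ℕ}

theorem colForm_mul_sub (v : Matrix (Fin 2) (Fin n) k) (i j : Fin n) :
    colForm v i 0 * colForm v j 1 - colForm v i 1 * colForm v j 0 =
      C (v 0 i * v 1 j - v 1 i * v 0 j) * detPoly k := by
  simp [colForm, detPoly]
  ring

theorem exists_colForm_mul_sub_eq (v : Matrix (Fin 2) (Fin n) k) (i j : Fin n) (c d : Fin 2) :
    ∃ r : k, colForm v i c * colForm v j d - colForm v i d * colForm v j c = C r * detPoly k := by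
  have h := colForm_mul_sub v i j
  fin_cases c <;> fin_cases d
  · exact ⟨0, by simp⟩
  · exact ⟨_, h⟩
  · exact ⟨-(v 0 i * v 1 j - v 1 i * v 0 j), by
      rw [C_neg, neg_mul, ← h, neg_sub]; rfl⟩
  · exact ⟨0, by simp⟩

theorem isHomogeneous_colForm (v : Matrix (Fin 2) (Fin n) k) (j : Fin n) (c : Fin 2) :
    (colForm v j c).IsHomogeneous 1 :=
  IsHomogeneous.sum _ _ _ fun _ _ => isHomogeneous_C_mul_X _ _

theorem coordPoly_eq_mul_prod (v : Matrix (Fin 2) (Fin n) k) (f : Fin n → Fin 2) {i j : Fin n}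
    (hij : i ≠ j) :
    coordPoly v f = colForm v i (f i) * colForm v j (f j) *
      ∏ l ∈ (Finset.univ.erase i).erase j, colForm v l (f l) := by
  rw [mul_assoc, Finset.mul_prod_erase _ (fun l => colForm v l (f l)) (by simp [hij.symm]),
    Finset.mul_prod_erase _ (fun l => colForm v l (f l)) (by simp), coordPoly]

variable (k n) in
/-- The multiples of the generic determinant that are homogeneous of degree `n`. -/
def detMultiples : Submodule k (MvPolynomial (Fin 2 × Fin 2) k) :=
  (homogeneousSubmodule (Fin 2 × Fin 2) k (n - 2)).map (LinearMap.mulLeft k (detPoly k))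

theorem detMultiples_eq_span :
    detMultiples k n = Submodule.span k (Set.range
      fun s : Finset.finsuppAntidiag (Finset.univ : Finset (Fin 2 × Fin 2)) (n - 2) =>
        detPoly k * monomial s.1 1) := by
  refine le_antisymm ?_ (Submodule.span_le.2 ?_)
  · rintro _ ⟨p, hp, rfl⟩
    rw [LinearMap.mulLeft_apply, p.as_sum, Finset.mul_sum]
    refine sum_mem fun s hs => ?_
    have hs' : s ∈ Finset.finsuppAntidiag (Finset.univ : Finset (Fin 2 × Fin 2)) (n - 2) := by
      rw [Finset.mem_finsuppAntidiag]
      refine ⟨?_, Finset.subset_univ _⟩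
      rw [← Finsupp.degree_eq_sum, Finsupp.degree_eq_weight_one]
      exact hp (mem_support_iff.1 hs)
    rw [show monomial s (coeff s p) = coeff s p • monomial s (1 : k) by simp [smul_monomial],
      mul_smul_comm]
    exact Submodule.smul_mem _ _ (Submodule.subset_span ⟨⟨s, hs'⟩, rfl⟩)
  · rintro _ ⟨⟨s, hs⟩, rfl⟩
    refine ⟨monomial s 1, isHomogeneous_monomial _ ?_, rfl⟩
    rw [Finsupp.degree_eq_sum]
    exact (Finset.mem_finsuppAntidiag.1 hs).1

theorem coordPoly_comp_swap_sub_mem (v : Matrix (Fin 2) (Fin n) k) (f : Fin n → Fin 2)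
    {i j : Fin n} (hij : i ≠ j) :
    coordPoly v (f ∘ Equiv.swap i j) - coordPoly v f ∈ detMultiples k n := by
  have hQ : ∏ l ∈ (Finset.univ.erase i).erase j, colForm v l ((f ∘ Equiv.swap i j) l) =
      ∏ l ∈ (Finset.univ.erase i).erase j, colForm v l (f l) := by
    refine Finset.prod_congr rfl fun l hl => ?_
    simp only [Finset.mem_erase] at hl
    rw [Function.comp_apply, Equiv.swap_apply_of_ne_of_ne hl.2.1 hl.1]
  obtain ⟨r, hr⟩ := exists_colForm_mul_sub_eq v i j (f j) (f i)
  refine ⟨C r * ∏ l ∈ (Finset.univ.erase i).erase j, colForm v l (f l), ?_, ?_⟩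
  · have := (isHomogeneous_C (Fin 2 × Fin 2) r).mul (IsHomogeneous.prod
      ((Finset.univ.erase i).erase j) (fun l => colForm v l (f l)) (fun _ => 1)
      fun l _ => isHomogeneous_colForm v l (f l))
    rw [SetLike.mem_coe, mem_homogeneousSubmodule]
    convert this using 1
    rw [Finset.sum_const, Finset.card_erase_of_mem (by simp [hij.symm]),
      Finset.card_erase_of_mem (by simp), Finset.card_univ, Fintype.card_fin]
    simp
    omega
  · rw [coordPoly_eq_mul_prod v _ hij, coordPoly_eq_mul_prod v f hij, hQ, ← sub_mul]
    simp only [Function.comp_apply, Equiv.swap_apply_left, Equiv.swap_apply_right, hr,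
      LinearMap.mulLeft_apply]
    ring

theorem coordPoly_comp_perm_sub_mem (v : Matrix (Fin 2) (Fin n) k) (π : Equiv.Perm (Fin n)) :
    ∀ f : Fin n → Fin 2, coordPoly v (f ∘ π) - coordPoly v f ∈ detMultiples k n := by
  refine Equiv.Perm.swap_induction_on π ?_ ?_
  · intro f
    simp
  · intro π i j hij ih f
    have := add_mem (ih (f ∘ Equiv.swap i j)) (coordPoly_comp_swap_sub_mem v f hij)
    rwa [sub_add_sub_cancel] at this

/-- The function with value `0` exactly at the first `i` indices. -/
def initZero (n i : ℕ) (j : Fin n) : Fin 2 :=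
  if (j : ℕ) < i then 0 else 1

theorem card_initZero {i : ℕ} (hi : i ≤ n) :
    Fintype.card {j // initZero n i j = 0} = i := by
  have : ∀ j : Fin n, initZero n i j = 0 ↔ (j : ℕ) < i := by
    intro j
    unfold initZero
    split_ifs <;> simp [*]
  simp only [Fintype.card_subtype, this]
  rw [Fin.card_filter_val_lt, min_eq_right hi]

theorem card_fiber_one (f : Fin n → Fin 2) :
    Fintype.card {j // f j = 1} = n - Fintype.card {j // f j = 0} := by
  have h : ∀ j, f j = 1 ↔ ¬ f j = 0 := fun j => by omega
  rw [Fintype.card_congr (Equiv.subtypeEquivRight h), Fintype.card_subtype_compl, Fintype.card_fin]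

theorem exists_initZero_comp_perm (f : Fin n → Fin 2) :
    ∃ i ≤ n, ∃ π : Equiv.Perm (Fin n), f = initZero n i ∘ π := by
  have hi : Fintype.card {j // f j = 0} ≤ n := by
    simpa using Fintype.card_subtype_le (fun j => f j = 0)
  refine ⟨_, hi, ?_⟩
  have h0 := card_initZero hi
  have e : ∀ c, Nonempty
      ({j // f j = c} ≃ {j // initZero n (Fintype.card {j // f j = 0}) j = c}) := by
    intro c
    refine ⟨Fintype.equivOfCardEq ?_⟩
    fin_cases c
    · exact h0.symm
    · exact (card_fiber_one _).trans ((congrArg (n - ·) h0.symm).trans (card_fiber_one _).symm)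
  exact ⟨Equiv.ofFiberEquiv fun c => (e c).some, funext fun j =>
    (Equiv.ofFiberEquiv_map (fun c => (e c).some) j).symm⟩

theorem prod_initZero {i : ℕ} (hi : i ≤ n) {M : Type*} [CommMonoid M] (d : Fin 2 → M) :
    ∏ j, d (initZero n i j) = d 0 ^ i * d 1 ^ (n - i) := by
  rw [← Fintype.prod_fiberwise (initZero n i), Fin.prod_univ_two]
  have h : ∀ c, ∏ j : {j // initZero n i j = c}, d (initZero n i j) =
      d c ^ Fintype.card {j // initZero n i j = c} := fun c => by
    rw [Finset.prod_congr rfl fun j _ => by rw [j.2], Finset.prod_const, Finset.card_univ]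
  rw [h, h, card_fiber_one, card_initZero hi]

theorem exists_colForm_combination (v : Matrix (Fin 2) (Fin n) k) {i j : Fin n}
    (h : v 0 i * v 1 j - v 1 i * v 0 j ≠ 0) (x : Fin 2 × Fin 2) :
    ∃ r s : k, X x = r • colForm v i x.1 + s • colForm v j x.1 := by
  obtain ⟨c, e⟩ := x
  set δ := v 0 i * v 1 j - v 1 i * v 0 j with hδ
  have key : ∀ y : MvPolynomial (Fin 2 × Fin 2) k, y = C δ⁻¹ * (C δ * y) := by
    intro y
    rw [← mul_assoc, ← C_mul, inv_mul_cancel₀ h, C_1, one_mul]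
  fin_cases e
  · refine ⟨δ⁻¹ * v 1 j, - (δ⁻¹ * v 1 i), ?_⟩
    refine (key _).trans ?_
    simp [colForm, smul_eq_C_mul, hδ]
    ring
  · refine ⟨- (δ⁻¹ * v 0 j), δ⁻¹ * v 0 i, ?_⟩
    refine (key _).trans ?_
    simp [colForm, smul_eq_C_mul, hδ]
    ring

/-- Products of linear forms at `d` distinct columns out of at least `d + 1` pairwise independent
ones span all forms of degree `d`. -/
theorem monomial_mem_span_prod_colForm (v : Matrix (Fin 2) (Fin n) k)
    (hv : ∀ i j, i ≠ j → v 0 i * v 1 j - v 1 i * v 0 j ≠ 0) (d : ℕ) :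
    ∀ A : Finset (Fin n), d + 1 ≤ A.card → ∀ s : Fin 2 × Fin 2 →₀ ℕ, s.degree = d →
      monomial s (1 : k) ∈ Submodule.span k {p | ∃ B ⊆ A, B.card = d ∧ ∃ f : Fin n → Fin 2,
        p = ∏ j ∈ B, colForm v j (f j)} := by
  induction d with
  | zero =>
    intro A _ s hs
    refine Submodule.subset_span ⟨∅, by simp, rfl, 0, ?_⟩
    rw [(Finsupp.degree_eq_zero_iff s).1 hs]
    simp
  | succ d ih =>
    intro A hA s hs
    obtain ⟨x, hx⟩ : ∃ x, s x ≠ 0 := by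
      by_contra! h
      rw [show s = 0 from Finsupp.ext h] at hs
      simp at hs
    obtain ⟨t, rfl⟩ : ∃ t, s = Finsupp.single x 1 + t :=
      ⟨s - Finsupp.single x 1, (add_tsub_cancel_of_le (by
        rw [Finsupp.single_le_iff]; omega)).symm⟩
    have ht : t.degree = d := by
      rw [map_add, Finsupp.degree_single] at hs
      omega
    have step : ∀ i ∈ A, colForm v i x.1 * monomial t 1 ∈ Submodule.span k
        {p | ∃ B ⊆ A, B.card = d + 1 ∧ ∃ f : Fin n → Fin 2, p = ∏ j ∈ B, colForm v j (f j)} := by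
      intro i hi
      have h := Submodule.mem_map_of_mem (f := LinearMap.mulLeft k (colForm v i x.1))
        (ih (A.erase i) (by rw [Finset.card_erase_of_mem hi]; omega) t ht)
      rw [Submodule.map_span] at h
      refine Submodule.span_mono ?_ h
      rintro _ ⟨_, ⟨B, hB, hBd, f, rfl⟩, rfl⟩
      have hiB : i ∉ B := fun h => by simpa using hB h
      refine ⟨insert i B, Finset.insert_subset hi (hB.trans (Finset.erase_subset _ _)),
        by rw [Finset.card_insert_of_notMem hiB, hBd], Function.update f i x.1, ?_⟩
      rw [Finset.prod_insert hiB, LinearMap.mulLeft_apply, Function.update_self]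
      congr 1
      refine Finset.prod_congr rfl fun j hj => ?_
      rw [Function.update_of_ne (ne_of_mem_of_not_mem hj hiB)]
    obtain ⟨i, hi, j, hj, hij⟩ := Finset.one_lt_card.1 (show 1 < A.card by omega)
    obtain ⟨r, r', hr⟩ := exists_colForm_combination v (hv i j hij) x
    rw [show monomial (Finsupp.single x 1 + t) (1 : k) = X x * monomial t 1 by
      rw [X, monomial_mul, one_mul], hr, add_mul, smul_mul_assoc, smul_mul_assoc]
    exact add_mem (Submodule.smul_mem _ _ (step i hi)) (Submodule.smul_mem _ _ (step j hj))

theorem detPoly_mul_monomial_mem (hn : 2 ≤ n) (v : Matrix (Fin 2) (Fin n) k)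
    (hv : ∀ i j, i ≠ j → v 0 i * v 1 j - v 1 i * v 0 j ≠ 0) (s : Fin 2 × Fin 2 →₀ ℕ)
    (hs : s.degree = n - 2) :
    detPoly k * monomial s 1 ∈ Submodule.span k (Set.range (coordPoly v)) := by
  have h := Submodule.mem_map_of_mem (f := LinearMap.mulLeft k (detPoly k))
    (monomial_mem_span_prod_colForm v hv (n - 2) Finset.univ
      (by rw [Finset.card_univ, Fintype.card_fin]; omega) s hs)
  rw [Submodule.map_span] at h
  refine Submodule.span_le.2 ?_ h
  rintro _ ⟨_, ⟨B, -, hB, f, rfl⟩, rfl⟩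
  obtain ⟨i, j, hij, hBc⟩ := Finset.card_eq_two.1 (show Bᶜ.card = 2 by
    rw [Finset.card_compl, hB, Fintype.card_fin]; omega)
  have hBe : (Finset.univ.erase i).erase j = B := by
    rw [← compl_compl B, hBc]
    ext l
    simp [and_comm]
  have hF : ∀ c d, colForm v i c * colForm v j d * ∏ l ∈ B, colForm v l (f l) ∈
      Submodule.span k (Set.range (coordPoly v)) := by
    intro c d
    refine Submodule.subset_span ⟨Function.update (Function.update f i c) j d, ?_⟩
    rw [coordPoly_eq_mul_prod v _ hij, hBe, Function.update_self, Function.update_of_ne hij,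
      Function.update_self]
    congr 1
    refine Finset.prod_congr rfl fun l hl => ?_
    rw [← hBe] at hl
    simp only [Finset.mem_erase] at hl
    rw [Function.update_of_ne hl.1, Function.update_of_ne hl.2.1]
  have hsub := sub_mem (hF 0 1) (hF 1 0)
  rw [← sub_mul, colForm_mul_sub, mul_assoc, ← smul_eq_C_mul] at hsub
  exact (Submodule.smul_mem_iff _ (hv i j hij)).1 hsub

/-- A family of polynomials, homogeneous for the rescaling of rows, that is a basis of the span of
the coordinates of `X v^⊗`. -/
def coordBasis (v : Matrix (Fin 2) (Fin n) k) :
    Fin (n + 1) ⊕ Finset.finsuppAntidiag (Finset.univ : Finset (Fin 2 × Fin 2)) (n - 2) →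
      MvPolynomial (Fin 2 × Fin 2) k :=
  Sum.elim (fun i => coordPoly v (initZero n i)) fun s => detPoly k * monomial s.1 1

theorem span_coordBasis (hn : 2 ≤ n) (v : Matrix (Fin 2) (Fin n) k)
    (hv : ∀ i j, i ≠ j → v 0 i * v 1 j - v 1 i * v 0 j ≠ 0) :
    Submodule.span k (Set.range (coordBasis v)) =
      Submodule.span k (Set.range (coordPoly v)) := by
  rw [coordBasis, Set.Sum.elim_range, Submodule.span_union, ← detMultiples_eq_span]
  refine le_antisymm (sup_le ?_ ?_) (Submodule.span_le.2 ?_)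
  · exact Submodule.span_mono (Set.range_subset_iff.2 fun i => ⟨_, rfl⟩)
  · rw [detMultiples_eq_span, Submodule.span_le]
    rintro _ ⟨⟨s, hs⟩, rfl⟩
    refine detPoly_mul_monomial_mem hn v hv s ?_
    rw [Finsupp.degree_eq_sum]
    exact (Finset.mem_finsuppAntidiag.1 hs).1
  · rintro _ ⟨f, rfl⟩
    obtain ⟨i, hi, π, rfl⟩ := exists_initZero_comp_perm f
    rw [SetLike.mem_coe, ← add_sub_cancel (coordPoly v (initZero n i)) (coordPoly v _)]
    exact Submodule.add_mem_sup
      (Submodule.subset_span ⟨⟨i, Nat.lt_succ_of_le hi⟩, rfl⟩)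
      (coordPoly_comp_perm_sub_mem v π _)

/-- Specialization of the generic matrix to the rank one matrices with rows `u` and `T u`. -/
def rankOneSpecialization (u : Fin 2 → k) : MvPolynomial (Fin 2 × Fin 2) k →ₐ[k] Polynomial k :=
  aeval fun x => Polynomial.C (u x.2) * ![1, Polynomial.X] x.1

theorem rankOneSpecialization_detPoly (u : Fin 2 → k) :
    rankOneSpecialization u (detPoly k) = 0 := by
  simp [rankOneSpecialization, detPoly]
  ring

theorem rankOneSpecialization_colForm (u : Fin 2 → k) (v : Matrix (Fin 2) (Fin n) k)
    (j : Fin n) (c : Fin 2) :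
    rankOneSpecialization u (colForm v j c) =
      Polynomial.C (∑ e, v e j * u e) * ![1, Polynomial.X] c := by
  simp [rankOneSpecialization, colForm, Polynomial.algebraMap_eq]
  ring

theorem rankOneSpecialization_coordPoly (u : Fin 2 → k) (v : Matrix (Fin 2) (Fin n) k) {i : ℕ}
    (hi : i ≤ n) :
    rankOneSpecialization u (coordPoly v (initZero n i)) =
      Polynomial.monomial (n - i) (∏ j, ∑ e, v e j * u e) := by
  rw [coordPoly, map_prod]
  simp only [rankOneSpecialization_colForm]
  rw [Finset.prod_mul_distrib, prod_initZero hi, ← map_prod, ← Polynomial.C_mul_X_pow_eq_monomial]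
  simp

theorem exists_forall_sum_mul_ne_zero [Infinite k] (v : Matrix (Fin 2) (Fin n) k)
    (hv : ∀ j, ∃ e, v e j ≠ 0) :
    ∃ u : Fin 2 → k, ∀ j, ∑ e, v e j * u e ≠ 0 := by
  by_contra! h
  have hp : ∏ j, ∑ e, C (v e j) * X e = (0 : MvPolynomial (Fin 2) k) := by
    refine MvPolynomial.funext fun u => ?_
    obtain ⟨j, hj⟩ := h u
    rw [map_prod, map_zero]
    refine Finset.prod_eq_zero (Finset.mem_univ j) ?_
    simpa using hj
  obtain ⟨j, -, hj⟩ := Finset.prod_eq_zero_iff.1 hp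
  obtain ⟨e, he⟩ := hv j
  apply he
  have := congrArg (eval (Pi.single e 1)) hj
  simpa only [map_sum, map_mul, eval_C, eval_X, Pi.single_apply, mul_ite, mul_one, mul_zero,
    Finset.sum_ite_eq', Finset.mem_univ, if_true, map_zero] using this

theorem linearIndependent_coordBasis [Infinite k] (v : Matrix (Fin 2) (Fin n) k)
    (hv : ∀ j, ∃ e, v e j ≠ 0) :
    LinearIndependent k (coordBasis v) := by
  obtain ⟨u, hu⟩ := exists_forall_sum_mul_ne_zero v hv
  have h1 : LinearIndependent k ((rankOneSpecialization u).toLinearMap ∘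
      fun i : Fin (n + 1) => coordPoly v (initZero n i)) := by
    have h := ((Polynomial.basisMonomials k).linearIndependent.comp
      (fun i : Fin (n + 1) => n - (i : ℕ)) fun i j hij => by
        apply Fin.ext
        have := i.2
        have := j.2
        simp only at hij
        omega).units_smul fun _ => Units.mk0 (∏ j, ∑ e, v e j * u e)
        (Finset.prod_ne_zero_iff.2 fun j _ => hu j)
    convert h using 1
    ext1 i
    simp only [Function.comp_apply, AlgHom.toLinearMap_apply]
    rw [rankOneSpecialization_coordPoly u v (by omega)]
    simp [Units.smul_def, Polynomial.smul_monomial]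
  refine LinearIndependent.sum_type (LinearIndependent.of_comp _ h1) ?_
    ((Submodule.range_ker_disjoint h1).mono_right (Submodule.span_le.2 ?_))
  · have h := ((basisMonomials (Fin 2 × Fin 2) k).linearIndependent.comp _
      (Subtype.val_injective (p := fun s => s ∈ Finset.finsuppAntidiag
        (Finset.univ : Finset (Fin 2 × Fin 2)) (n - 2)))).map'
      (LinearMap.mulLeft k (detPoly k))
      (LinearMap.ker_eq_bot.2 (mul_right_injective₀ (detPoly_ne_zero k)))
    rw [coe_basisMonomials] at h
    exact h
  · rintro _ ⟨s, rfl⟩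
    simp [rankOneSpecialization_detPoly]

/-- The eigenvalues of the rescaling of rows on `coordBasis`. -/
def coordBasisWeight (n : ℕ) (d : Fin 2 → k) :
    Fin (n + 1) ⊕ Finset.finsuppAntidiag (Finset.univ : Finset (Fin 2 × Fin 2)) (n - 2) → k :=
  Sum.elim (fun i => d 0 ^ (i : ℕ) * d 1 ^ (n - i)) fun s =>
    d 0 * d 1 * (d 0 ^ (s.1 (0, 0) + s.1 (0, 1)) * d 1 ^ (s.1 (1, 0) + s.1 (1, 1)))

theorem rowScale_coordBasis (d : Fin 2 → k) (v : Matrix (Fin 2) (Fin n) k) (x) :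
    rowScale d (coordBasis v x) = coordBasisWeight n d x • coordBasis v x := by
  rcases x with i | s
  · simp only [coordBasis, coordBasisWeight, Sum.elim_inl]
    rw [rowScale_coordPoly, prod_initZero (by omega)]
  · simp only [coordBasis, coordBasisWeight, Sum.elim_inr]
    rw [map_mul, rowScale_detPoly, rowScale_monomial, smul_mul_smul_comm]

theorem sum_coordBasisWeight (hn : 2 ≤ n) (d : Fin 2 → k) :
    ∑ x, coordBasisWeight n d x =
      (∑ i ∈ Finset.range (n + 1), d 0 ^ i * d 1 ^ (n - i)) +
        ∑ i ∈ Finset.range (n + 1), ((i * (n - i) : ℕ) : k) * (d 0 ^ i * d 1 ^ (n - i)) := by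
  rw [Fintype.sum_sum_type]
  simp only [coordBasisWeight, Sum.elim_inl, Sum.elim_inr]
  rw [Fin.sum_univ_eq_sum_range fun i => d 0 ^ i * d 1 ^ (n - i), ← Finset.mul_sum,
    Finset.sum_coe_sort (Finset.finsuppAntidiag (Finset.univ : Finset (Fin 2 × Fin 2)) (n - 2))
      fun s => d 0 ^ (s (0, 0) + s (0, 1)) * d 1 ^ (s (1, 0) + s (1, 1)),
    sum_finsuppAntidiag_weights]
  obtain ⟨m, rfl⟩ := Nat.exists_eq_add_of_le hn
  rw [show 2 + m + 1 = m + 1 + 1 + 1 by ring, Finset.sum_range_succ _ (m + 1 + 1),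
    Finset.sum_range_succ' _ (m + 1), Finset.mul_sum,
    Finset.sum_range_succ (n := m + 1 + 1), Finset.sum_range_succ' (n := m + 1)]
  rw [show 2 + m - (m + 1 + 1) = 0 by omega, Nat.add_sub_cancel_left]
  simp only [mul_zero, zero_mul, Nat.cast_zero, add_zero]
  congr 1
  refine Finset.sum_congr rfl fun i hi => ?_
  rw [Finset.mem_range] at hi
  rw [show 2 + m - (i + 1) = m - i + 1 by omega]
  ring

end SpanningFamily

/-- The character of the tensor module of `U_{2,n}`: for `v ∈ k^{2×n}` with uniform
matroid, `diag(a,b)` preserves `G(v)` and the trace of the induced endomorphism is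
`s_{(n,0)}(a,b) + ∑_{ℓ=1}^{n/2} (n−2ℓ+1) s_{(n−ℓ,ℓ)}(a,b)`. -/
theorem character_of_tensor_module_uniform_rank_two
    {k : Type*} [Field k] [CharZero k] {n : ℕ} (hn : 2 ≤ n)
    (v : Matrix (Fin 2) (Fin n) k)
    (huni : ∀ j j' : Fin n, j ≠ j' →
      LinearIndependent k ![fun i => v i j, fun i => v i j'])
    (a b : kˣ) :
    ∃ hpres : ∀ x ∈ tensMod k v,
        diagAct k (Matrix.diagonal ![(a : k), (b : k)]) x ∈ tensMod k v,
      LinearMap.trace k ↥(tensMod k v)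
          ((diagAct k (n := n) (Matrix.diagonal ![(a : k), (b : k)])).restrict hpres) =
        (∑ i ∈ Finset.range (n + 1), (a : k) ^ i * (b : k) ^ (n - i)) +
          ∑ l ∈ Finset.Icc 1 (n / 2), ((n - 2 * l + 1 : ℕ) : k) *
            ∑ i ∈ Finset.Icc l (n - l), (a : k) ^ i * (b : k) ^ (n - i) := by
  have hv : ∀ i j, i ≠ j → v 0 i * v 1 j - v 1 i * v 0 j ≠ 0 := by
    intro i j hij
    have h := Matrix.linearIndependent_rows_iff_isUnit
      (A := Matrix.of ![fun e => v e i, fun e => v e j]) |>.1 (huni i j hij)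
    rw [Matrix.isUnit_iff_isUnit_det, isUnit_iff_ne_zero, Matrix.det_fin_two] at h
    simpa [mul_comm] using h
  have hv0 : ∀ j, ∃ e, v e j ≠ 0 := by
    intro j
    have : Nontrivial (Fin n) := Fin.nontrivial_iff_two_le.2 hn
    obtain ⟨i, hi⟩ := exists_ne j
    by_contra! h
    exact hv j i hi.symm (by simp [h])
  have hdiag : IsUnit (Matrix.diagonal ![(a : k), (b : k)]) := by
    rw [Matrix.isUnit_iff_isUnit_det, Matrix.det_diagonal, isUnit_iff_ne_zero]
    simp
  have : FiniteDimensional k (PiTensorProduct k fun _ : Fin n => Fin 2 → k) :=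
    (tensBasis k n).finiteDimensional_of_finite
  refine ⟨diagAct_mem_tensMod v hdiag, ?_⟩
  rw [trace_restrict_eq_sum_of_dual (tensMod k v) _ _ (dualToPoly v) (ker_dualToPoly v)
    (rowScale ![(a : k), (b : k)]).toLinearMap (dualToPoly_comp_diagAct _ v) (coordBasis v)
    (linearIndependent_coordBasis v hv0) ((span_coordBasis hn v hv).trans (range_dualToPoly v).symm)
    (coordBasisWeight n ![(a : k), (b : k)]) (rowScale_coordBasis _ v),
    sum_coordBasisWeight hn, sum_weights_eq]
  rfl
end
end
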